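/- arXiv:2011.11533 — 2 statements merged into one kernel-verified Lean document; each statement's English description precedes it below -/
import Mathlib

section
/- An L¹ convergence result: let h : [0,T]×Ō → ℝ be bounded and continuous, let (μⁿ, mⁿ)_{n≥1} ⊆ R and m ∈ V be such that mⁿ → m in V (i.e. the finite measures m_tⁿ(dx,da)dt on [0,T]×Ō×A converge weakly to m_t(dx,da)dt). Then the functions t ↦ ∫_{Ō×A} h(t,x) m_tⁿ(dx,da) converge to t ↦ ∫_{Ō×A} h(t,x) m_t(dx,da) in L¹([0,T]). -/
open MeasureTheory Filter Set Topology

noncomputable section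

/-- Membership in `C_b^{1,2}([0,T] × closure O)`: `u` together with its partial
derivatives `ut = ∂_t u`, `ux = ∂_x u`, `uxx = ∂_xx u`, all continuous and bounded
on `[0,T] × closure O`. -/
structure IsCb12 (T : ℝ) (O : Set ℝ) (u ut ux uxx : ℝ → ℝ → ℝ) : Prop where
  cont : ContinuousOn (fun p : ℝ × ℝ => u p.1 p.2) (Set.Icc 0 T ×ˢ closure O)
  cont_t : ContinuousOn (fun p : ℝ × ℝ => ut p.1 p.2) (Set.Icc 0 T ×ˢ closure O)
  cont_x : ContinuousOn (fun p : ℝ × ℝ => ux p.1 p.2) (Set.Icc 0 T ×ˢ closure O)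
  cont_xx : ContinuousOn (fun p : ℝ × ℝ => uxx p.1 p.2) (Set.Icc 0 T ×ˢ closure O)
  deriv_t : ∀ t ∈ Set.Icc (0:ℝ) T, ∀ x ∈ closure O,
    HasDerivWithinAt (fun s => u s x) (ut t x) (Set.Icc 0 T) t
  deriv_x : ∀ t ∈ Set.Icc (0:ℝ) T, ∀ x ∈ closure O,
    HasDerivWithinAt (fun y => u t y) (ux t x) (closure O) x
  deriv_xx : ∀ t ∈ Set.Icc (0:ℝ) T, ∀ x ∈ closure O,
    HasDerivWithinAt (fun y => ux t y) (uxx t x) (closure O) x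
  bdd : ∃ C : ℝ, ∀ t ∈ Set.Icc (0:ℝ) T, ∀ x ∈ closure O,
    |u t x| ≤ C ∧ |ut t x| ≤ C ∧ |ux t x| ≤ C ∧ |uxx t x| ≤ C

/-- Membership in `V`: a flow of finite positive Borel measures on
`closure O × A`, measurable in `t`, with integrable total mass on `[0,T]`. -/
def MemV (T : ℝ) (O A : Set ℝ) (m : ℝ → Measure (ℝ × ℝ)) : Prop :=
  (∀ t, m t Set.univ < ⊤) ∧
  (∀ t, m t ((closure O ×ˢ A)ᶜ) = 0) ∧
  (∀ B : Set (ℝ × ℝ), MeasurableSet B → Measurable fun t => m t B) ∧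
  IntegrableOn (fun t => (m t Set.univ).toReal) (Set.Icc 0 T)

/-- Standing assumptions on the coefficients `b` and `σ` (single-agent case):
measurable, bounded, Lipschitz in `x` uniformly in `(t,a)`, nonnegative diffusion,
and jointly continuous in `(x,a)` on `closure O × A` for each fixed `t`. -/
def CoefAssumption (O A : Set ℝ) (b σ : ℝ → ℝ → ℝ → ℝ) : Prop :=
  Measurable (fun q : ℝ × ℝ × ℝ => b q.1 q.2.1 q.2.2) ∧
  Measurable (fun q : ℝ × ℝ × ℝ => σ q.1 q.2.1 q.2.2) ∧
  (∃ C : ℝ, ∀ t x a, |b t x a| ≤ C ∧ |σ t x a| ≤ C) ∧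
  (∀ t x a, 0 ≤ σ t x a) ∧
  (∃ K : ℝ, ∀ t a x y, |b t x a - b t y a| ≤ K * |x - y| ∧ |σ t x a - σ t y a| ≤ K * |x - y|) ∧
  (∀ t, ContinuousOn (fun p : ℝ × ℝ => b t p.1 p.2) (closure O ×ˢ A)) ∧
  (∀ t, ContinuousOn (fun p : ℝ × ℝ => σ t p.1 p.2) (closure O ×ˢ A))

/-- Standing assumption on the initial measure: a probability measure on `O` with
`∫ ln(1 + |x|) dm₀* < ∞`. -/
def InitAssumption (O : Set ℝ) (m0 : Measure ℝ) : Prop :=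
  IsProbabilityMeasure m0 ∧ m0 Oᶜ = 0 ∧ Integrable (fun x => Real.log (1 + |x|)) m0

/-- Membership in the constraint set `R`: `μ` is a probability measure on
`[0,T] × closure O`, `m ∈ V`, and the Fokker–Planck constraint holds for all
test functions in `C_b^{1,2}`. -/
def MemR (T : ℝ) (O A : Set ℝ) (b σ : ℝ → ℝ → ℝ → ℝ) (m0 : Measure ℝ)
    (μ : Measure (ℝ × ℝ)) (m : ℝ → Measure (ℝ × ℝ)) : Prop :=
  IsProbabilityMeasure μ ∧ μ ((Set.Icc 0 T ×ˢ closure O)ᶜ) = 0 ∧ MemV T O A m ∧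
  ∀ u ut ux uxx : ℝ → ℝ → ℝ, IsCb12 T O u ut ux uxx →
    ∫ p, u p.1 p.2 ∂μ
      = (∫ x, u 0 x ∂m0)
        + ∫ t in Set.Icc 0 T,
            (∫ p, (ut t p.1 + (b t p.1 p.2 * ux t p.1 + σ t p.1 p.2 ^ 2 / 2 * uxx t p.1)) ∂(m t))

/-- Weak convergence of (finite) measures on `[0,T] × closure O` (tested against
bounded continuous functions). -/
def WeakConv (μn : ℕ → Measure (ℝ × ℝ)) (μ : Measure (ℝ × ℝ)) : Prop :=
  ∀ h : ℝ × ℝ → ℝ, Continuous h → (∃ C : ℝ, ∀ p, |h p| ≤ C) →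
    Tendsto (fun n => ∫ p, h p ∂(μn n)) atTop (nhds (∫ p, h p ∂μ))

/-- Convergence `mⁿ → m` in `V`: weak convergence of the associated finite
measures `m_tⁿ(dx,da)dt` on `[0,T] × closure O × A`. -/
def ConvV (T : ℝ) (mn : ℕ → ℝ → Measure (ℝ × ℝ)) (m : ℝ → Measure (ℝ × ℝ)) : Prop :=
  ∀ h : ℝ → ℝ × ℝ → ℝ, Continuous (fun q : ℝ × ℝ × ℝ => h q.1 q.2) →
    (∃ C : ℝ, ∀ t p, |h t p| ≤ C) →
    Tendsto (fun n => ∫ t in Set.Icc 0 T, (∫ p, h t p ∂(mn n t))) atTop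
      (nhds (∫ t in Set.Icc 0 T, (∫ p, h t p ∂(m t))))

/-- The linear-programming reward functional
`Γ(μ, m) = ∫₀^T ∫ f(t,x,a) m_t(dx,da) dt + ∫ g(t,x) μ(dt,dx)`. -/
def LPGamma (T : ℝ) (f : ℝ → ℝ → ℝ → ℝ) (g : ℝ → ℝ → ℝ)
    (μ : Measure (ℝ × ℝ)) (m : ℝ → Measure (ℝ × ℝ)) : ℝ :=
  (∫ t in Set.Icc 0 T, ∫ p, f t p.1 p.2 ∂(m t)) + ∫ p, g p.1 p.2 ∂μ

/-- Standing assumptions on the reward functions `f` and `g`: `f` measurable,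
bounded, upper semicontinuous in `(x,a)` for each `t`; `g` upper semicontinuous
and bounded from above. -/
def RewardAssumption (T : ℝ) (O A : Set ℝ) (f : ℝ → ℝ → ℝ → ℝ) (g : ℝ → ℝ → ℝ) : Prop :=
  Measurable (fun q : ℝ × ℝ × ℝ => f q.1 q.2.1 q.2.2) ∧
  (∃ C : ℝ, ∀ t x a, |f t x a| ≤ C) ∧
  (∀ t, UpperSemicontinuousOn (fun p : ℝ × ℝ => f t p.1 p.2) (closure O ×ˢ A)) ∧
  UpperSemicontinuousOn (fun p : ℝ × ℝ => g p.1 p.2) (Set.Icc 0 T ×ˢ closure O) ∧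
  (∃ C : ℝ, ∀ t x, g t x ≤ C)


/-- Totally bounded primitives. -/
lemma primitives_net (T : ℝ) (ε : ℝ) (hε : 0 < ε) :
    ∃ F : Set (ℝ → ℝ), F.Finite ∧ (∀ θ ∈ F, Continuous θ ∧ ∀ t, |θ t| ≤ 1) ∧
      ∀ θ : ℝ → ℝ, Continuous θ → (∀ t, |θ t| ≤ 1) → ∃ θ' ∈ F, ∀ t ∈ Set.Icc (0:ℝ) T,
        |(∫ s in (0:ℝ)..t, θ s) - ∫ s in (0:ℝ)..t, θ' s| ≤ ε := by
  classical
  let S := {θ : ℝ → ℝ // Continuous θ ∧ ∀ t, |θ t| ≤ 1}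
  have hlip : ∀ θ : S, ∀ x y : ℝ, |(∫ s in (0:ℝ)..x, θ.1 s) - ∫ s in (0:ℝ)..y, θ.1 s| ≤ |x - y| := by
    intro θ x y
    rw [intervalIntegral.integral_interval_sub_left (θ.2.1.intervalIntegrable _ _)
      (θ.2.1.intervalIntegrable _ _)]
    have := intervalIntegral.norm_integral_le_of_norm_le_const (a := y) (b := x) (f := θ.1) (C := 1)
      (fun s _ => θ.2.2 s)
    simpa using this
  have hcont : ∀ θ : S, Continuous (fun x : Set.Icc (0:ℝ) T => ∫ s in (0:ℝ)..(x:ℝ), θ.1 s) := by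
    intro θ
    have : LipschitzWith 1 (fun x : Set.Icc (0:ℝ) T => ∫ s in (0:ℝ)..(x:ℝ), θ.1 s) := by
      apply LipschitzWith.of_dist_le_mul
      intro x y
      simpa [Real.dist_eq, Subtype.dist_eq] using hlip θ x y
    exact this.continuous
  let G : S → BoundedContinuousFunction (Set.Icc (0:ℝ) T) ℝ := fun θ =>
    BoundedContinuousFunction.mkOfCompact ⟨_, hcont θ⟩
  have hG : ∀ θ x, G θ x = ∫ s in (0:ℝ)..(x:ℝ), θ.1 s := fun θ x => rfl
  have hcomp : IsCompact (closure (Set.range G)) := by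
    apply BoundedContinuousFunction.arzela_ascoli (Set.Icc (-T) T) isCompact_Icc
    · rintro f x ⟨θ, rfl⟩
      rw [hG]
      have := hlip θ x 0
      simp only [intervalIntegral.integral_same, sub_zero] at this
      rw [abs_of_nonneg x.2.1] at this
      exact abs_le.1 (this.trans x.2.2)
    · apply Metric.equicontinuous_of_continuity_modulus (fun d => d) tendsto_id
      rintro x y ⟨f, θ, rfl⟩
      simpa [Real.dist_eq, Subtype.dist_eq, hG] using hlip θ x y
  have htb : TotallyBounded (Set.range G) := hcomp.totallyBounded.subset subset_closure
  obtain ⟨t, hts, htf, hcov⟩ := Metric.finite_approx_of_totallyBounded htb ε hε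
  have : ∀ f : t, ∃ θ : S, G θ = f := fun f => hts f.2
  choose g hg using this
  have : Finite t := htf
  refine ⟨Set.range (fun f : t => (g f).1), Set.finite_range _, ?_, ?_⟩
  · rintro θ ⟨f, rfl⟩
    exact (g f).2
  · intro θ hθ hθ1
    have h1 := hcov ⟨⟨θ, hθ, hθ1⟩, rfl⟩
    simp only [Set.mem_iUnion, exists_prop] at h1
    obtain ⟨f, hf, hd⟩ := h1
    refine ⟨_, ⟨⟨f, hf⟩, rfl⟩, fun s hs => ?_⟩
    have h2 := (BoundedContinuousFunction.dist_coe_le_dist (⟨s, hs⟩ : Set.Icc (0:ℝ) T)).trans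
      (Metric.mem_ball.1 hd).le
    have h3 : f ⟨s, hs⟩ = G (g ⟨f, hf⟩) ⟨s, hs⟩ := by rw [hg ⟨f, hf⟩]
    rw [h3, Real.dist_eq, hG, hG] at h2
    exact h2

/-- Duality bound for the `L¹` norm. -/
lemma L1_dual (T : ℝ) (hT : 0 < T) (d : ℝ → ℝ) (hd : IntegrableOn d (Set.Icc 0 T)) (ε : ℝ)
    (h : ∀ θ : ℝ → ℝ, Continuous θ → (∀ t, |θ t| ≤ 1) → |∫ t in Set.Icc 0 T, θ t * d t| ≤ ε) :
    ∫ t in Set.Icc 0 T, |d t| ≤ ε := by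
  refine le_of_forall_pos_le_add fun η hη => ?_
  obtain ⟨c, -, hc1, hc2, hc3⟩ :=
    Integrable.exists_hasCompactSupport_integral_sub_le hd (ε := η / 4) (by positivity)
  set δ := η / (2 * T) with hδ
  have hδ0 : 0 < δ := by positivity
  have hpos : ∀ t, 0 < |c t| + δ := fun t => by positivity
  set θ : ℝ → ℝ := fun t => c t / (|c t| + δ) with hθ
  have hθc : Continuous θ := hc2.div (by fun_prop) (fun t => (hpos t).ne')
  have hθ1 : ∀ t, |θ t| ≤ 1 := fun t => by
    rw [hθ]; simp only [abs_div, abs_of_pos (hpos t)]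
    rw [div_le_one (hpos t)]; linarith
  have h1 := h θ hθc hθ1
  have hint : IntegrableOn (fun t => θ t * d t) (Set.Icc 0 T) :=
    hd.bdd_mul (c := 1) hθc.aestronglyMeasurable (Eventually.of_forall hθ1)
  have hsub : Integrable (fun t => ‖d t - c t‖) (volume.restrict (Set.Icc 0 T)) := (hd.sub hc3).norm
  have h2 : ∫ t in Set.Icc 0 T, |d t| ≤
      ∫ t in Set.Icc 0 T, (θ t * d t + 2 * ‖d t - c t‖ + δ) := by
    apply integral_mono hd.abs ((hint.add (hsub.const_mul 2)).add (integrable_const δ))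
    intro t
    simp only [Real.norm_eq_abs]
    have e1 : |c t| - δ ≤ θ t * c t := by
      have : θ t * c t = |c t| ^ 2 / (|c t| + δ) := by
        rw [hθ, sq_abs]; ring
      rw [this, le_div_iff₀ (hpos t)]
      nlinarith [sq_nonneg δ]
    have e2 : θ t * c t - θ t * d t ≤ |d t - c t| := by
      have : |θ t * (c t - d t)| ≤ 1 * |c t - d t| := by
        rw [abs_mul]; gcongr; exact hθ1 t
      rw [abs_sub_comm (d t)]
      nlinarith [le_abs_self (θ t * (c t - d t))]
    have e3 : |d t| ≤ |c t| + |d t - c t| := by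
      have := abs_add_le (c t) (d t - c t); simpa using this
    show |d t| ≤ θ t * d t + 2 * |d t - c t| + δ
    linarith
  have hadd : Integrable (fun t => θ t * d t + 2 * ‖d t - c t‖) (volume.restrict (Set.Icc 0 T)) :=
    hint.add (hsub.const_mul 2)
  rw [integral_add hadd (integrable_const δ),
    integral_add hint (hsub.const_mul 2), integral_const_mul] at h2
  simp only [integral_const, smul_eq_mul] at h2
  have hvol : (volume.restrict (Set.Icc 0 T)).real Set.univ = T := by
    simp [Measure.real, hT.le]
  rw [hvol] at h2
  have : T * δ = η / 2 := by rw [hδ]; field_simp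
  have := le_abs_self (∫ t in Set.Icc 0 T, θ t * d t)
  linarith

/-- Compactness lemma: uniform bounded variation and weak convergence give `L¹` convergence. -/
lemma BV_L1 (T : ℝ) (hT : 0 < T) (g : ℕ → ℝ → ℝ) (g' : ℝ → ℝ)
    (hg : ∀ n, IntegrableOn (g n) (Set.Icc 0 T)) (hg' : IntegrableOn g' (Set.Icc 0 T))
    (C : ℝ) (hC : 0 ≤ C)
    (hBV : ∀ n, ∀ φ θ : ℝ → ℝ, Continuous θ → (∀ t, HasDerivAt φ (θ t) t) → ∀ δ : ℝ,
      (∀ t ∈ Set.Icc (0:ℝ) T, |φ t| ≤ δ) → |∫ t in Set.Icc 0 T, θ t * g n t| ≤ C * δ)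
    (hw : ∀ θ : ℝ → ℝ, Continuous θ → (∃ B, ∀ t, |θ t| ≤ B) →
      Tendsto (fun n => ∫ t in Set.Icc 0 T, θ t * g n t) atTop
        (nhds (∫ t in Set.Icc 0 T, θ t * g' t))) :
    Tendsto (fun n => ∫ t in Set.Icc 0 T, |g n t - g' t|) atTop (nhds 0) := by
  rw [Metric.tendsto_atTop]
  intro ε hε
  set δ := ε / (8 * (C + 1)) with hδ
  have hδ0 : 0 < δ := by positivity
  obtain ⟨F, hF, hF1, hF2⟩ := primitives_net T δ hδ0
  have hmul : ∀ θ : ℝ → ℝ, Continuous θ → ∀ B : ℝ, (∀ t, |θ t| ≤ B) → ∀ f : ℝ → ℝ,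
      IntegrableOn f (Set.Icc 0 T) → IntegrableOn (fun t => θ t * f t) (Set.Icc 0 T) := by
    intro θ hθ B hB f hf
    exact hf.bdd_mul (c := B) hθ.aestronglyMeasurable (Eventually.of_forall hB)
  have hev : ∀ᶠ n in atTop, ∀ θ ∈ F,
      |(∫ t in Set.Icc 0 T, θ t * g n t) - ∫ t in Set.Icc 0 T, θ t * g' t| < ε / 4 := by
    rw [Filter.eventually_all_finite hF]
    intro θ hθ
    have := hw θ (hF1 θ hθ).1 ⟨1, (hF1 θ hθ).2⟩
    have := (Metric.tendsto_nhds.1 this) (ε / 4) (by positivity)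
    simpa [Real.dist_eq] using this
  obtain ⟨N, hN⟩ := eventually_atTop.1 hev
  refine ⟨N, fun n hn => ?_⟩
  have key : ∫ t in Set.Icc 0 T, |g n t - g' t| ≤ ε / 2 := by
    apply L1_dual T hT (fun t => g n t - g' t) ((hg n).sub hg')
    intro θ hθ hθ1
    obtain ⟨θ', hθ'F, hθ'⟩ := hF2 θ hθ hθ1
    obtain ⟨hc', hb'⟩ := hF1 θ' hθ'F
    have hb : ∀ t, |θ t - θ' t| ≤ 2 := fun t => by
      have := abs_sub (θ t) (θ' t); linarith [hθ1 t, hb' t]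
    have hBVn : ∀ n, |∫ t in Set.Icc 0 T, (θ t - θ' t) * g n t| ≤ C * δ := by
      intro n
      refine hBV n (fun t => (∫ s in (0:ℝ)..t, θ s) - ∫ s in (0:ℝ)..t, θ' s) (fun t => θ t - θ' t)
        (hθ.sub hc') (fun t => ?_) δ hθ'
      exact (hθ.integral_hasStrictDerivAt 0 t).hasDerivAt.sub
        (hc'.integral_hasStrictDerivAt 0 t).hasDerivAt
    have hBV' : |∫ t in Set.Icc 0 T, (θ t - θ' t) * g' t| ≤ C * δ := by
      refine le_of_tendsto ((hw (fun t => θ t - θ' t) (hθ.sub hc') ⟨2, hb⟩).abs)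
        (Eventually.of_forall hBVn)
    have hsplit : ∫ t in Set.Icc 0 T, θ t * (g n t - g' t) =
        (∫ t in Set.Icc 0 T, (θ t - θ' t) * g n t) - (∫ t in Set.Icc 0 T, (θ t - θ' t) * g' t)
        + ((∫ t in Set.Icc 0 T, θ' t * g n t) - ∫ t in Set.Icc 0 T, θ' t * g' t) := by
      have i1 := hmul (fun t => θ t - θ' t) (hθ.sub hc') 2 hb _ (hg n)
      have i2 := hmul (fun t => θ t - θ' t) (hθ.sub hc') 2 hb _ hg'
      have i3 := hmul _ hc' 1 hb' _ (hg n)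
      have i4 := hmul _ hc' 1 hb' _ hg'
      have i5 : IntegrableOn (fun t => (θ t - θ' t) * g n t - (θ t - θ' t) * g' t) (Set.Icc 0 T) :=
        i1.sub i2
      have i6 : IntegrableOn (fun t => θ' t * g n t - θ' t * g' t) (Set.Icc 0 T) := i3.sub i4
      rw [← integral_sub i1 i2, ← integral_sub i3 i4, ← integral_add i5 i6]
      congr 1; ext t; ring
    have h3 := hN n hn θ' hθ'F
    have h4 : C * δ ≤ ε / 8 := by
      rw [hδ]
      have : C * (ε / (8 * (C + 1))) = ε / 8 * (C / (C + 1)) := by field_simp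
      rw [this]
      have : C / (C + 1) ≤ 1 := by rw [div_le_one (by linarith)]; linarith
      nlinarith
    rw [hsplit]
    refine (abs_add_le _ _).trans ?_
    have := abs_sub (∫ t in Set.Icc 0 T, (θ t - θ' t) * g n t)
      (∫ t in Set.Icc 0 T, (θ t - θ' t) * g' t)
    linarith [hBVn n]
  rw [Real.dist_eq, sub_zero, abs_of_nonneg (integral_nonneg fun t => abs_nonneg _)]
  linarith

/-- Measurability of parametrized integrals along a flow. -/
lemma meas_int (m : ℝ → Measure (ℝ × ℝ)) (hfin : ∀ t, m t Set.univ < ⊤)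
    (hm : ∀ B : Set (ℝ × ℝ), MeasurableSet B → Measurable fun t => m t B)
    (f : ℝ → ℝ × ℝ → ℝ) (hf : Measurable (fun q : ℝ × (ℝ × ℝ) => f q.1 q.2)) :
    Measurable (fun t => ∫ p, f t p ∂(m t)) := by
  let κ : ProbabilityTheory.Kernel ℝ (ℝ × ℝ) :=
    ⟨fun t => (m t Set.univ)⁻¹ • m t, Measure.measurable_of_measurable_coe _ fun B hB => by
      simp only [Measure.smul_apply, smul_eq_mul]
      exact (hm _ MeasurableSet.univ).inv.mul (hm B hB)⟩
  have hκ : ∀ t, κ t = (m t Set.univ)⁻¹ • m t := fun t => rfl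
  have : ProbabilityTheory.IsFiniteKernel κ := by
    refine ⟨⟨1, ENNReal.one_lt_top, fun t => ?_⟩⟩
    rw [hκ, Measure.smul_apply, smul_eq_mul]
    exact ENNReal.inv_mul_le_one _
  have h1 : Measurable (fun t => ∫ p, f t p ∂(κ t)) :=
    (StronglyMeasurable.integral_kernel_prod_right' (κ := κ) hf.stronglyMeasurable).measurable
  have h2 : (fun t => ∫ p, f t p ∂(m t)) =
      fun t => (m t Set.univ).toReal * ∫ p, f t p ∂(κ t) := by
    ext t
    rw [hκ, integral_smul_measure, smul_eq_mul, ← mul_assoc, ENNReal.toReal_inv]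
    by_cases h0 : m t Set.univ = 0
    · have : m t = 0 := Measure.measure_univ_eq_zero.1 h0
      simp [this]
    · rw [mul_inv_cancel₀, one_mul]
      exact (ENNReal.toReal_pos h0 (hfin t).ne).ne'
  rw [h2]
  exact (hm _ MeasurableSet.univ).ennreal_toReal.mul h1

lemma bound_int {T : ℝ} {O A : Set ℝ} {m : ℝ → Measure (ℝ × ℝ)} (hm : MemV T O A m)
    (f : ℝ × ℝ → ℝ) (C : ℝ) (hC : ∀ p, |f p| ≤ C) (t : ℝ) :
    |∫ p, f p ∂(m t)| ≤ C * (m t Set.univ).toReal := by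
  have : IsFiniteMeasure (m t) := ⟨hm.1 t⟩
  exact norm_integral_le_of_norm_le_const (μ := m t) (f := f) (Eventually.of_forall hC)

lemma intOn_int {T : ℝ} {O A : Set ℝ} {m : ℝ → Measure (ℝ × ℝ)} (hm : MemV T O A m)
    (f : ℝ → ℝ × ℝ → ℝ) (hf : Measurable (fun q : ℝ × (ℝ × ℝ) => f q.1 q.2))
    (C : ℝ) (hC : ∀ t p, |f t p| ≤ C) :
    IntegrableOn (fun t => ∫ p, f t p ∂(m t)) (Set.Icc 0 T) := by
  refine Integrable.mono' (hm.2.2.2.const_mul C)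
    (meas_int m hm.1 hm.2.2.1 f hf).aestronglyMeasurable (Eventually.of_forall fun t => ?_)
  exact bound_int hm (f t) C (hC t) t

lemma int_bdd {T : ℝ} {O A : Set ℝ} {m : ℝ → Measure (ℝ × ℝ)} (hm : MemV T O A m)
    (f : ℝ × ℝ → ℝ) (hf : Measurable f) (C : ℝ) (hC : ∀ p, |f p| ≤ C) (t : ℝ) :
    Integrable f (m t) := by
  have : IsFiniteMeasure (m t) := ⟨hm.1 t⟩
  exact Integrable.of_bound hf.aestronglyMeasurable C (Eventually.of_forall hC)

/-- Uniform variation bound obtained from the Fokker–Planck constraint. -/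
lemma FP_bound {T : ℝ} (hT : 0 < T) {O A : Set ℝ} {b σ : ℝ → ℝ → ℝ → ℝ}
    (hb : Measurable (fun q : ℝ × ℝ × ℝ => b q.1 q.2.1 q.2.2))
    (hσ : Measurable (fun q : ℝ × ℝ × ℝ => σ q.1 q.2.1 q.2.2))
    (C0 : ℝ) (hC0 : ∀ t x a, |b t x a| ≤ C0 ∧ |σ t x a| ≤ C0)
    (m0 : Measure ℝ) [IsProbabilityMeasure m0]
    {μ : Measure (ℝ × ℝ)} {m : ℝ → Measure (ℝ × ℝ)} (hR : MemR T O A b σ m0 μ m)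
    (ψ ψ1 ψ2 : ℝ → ℝ) (h2c : Continuous ψ2) (hd1 : ∀ x, HasDerivAt ψ (ψ1 x) x)
    (hd2 : ∀ x, HasDerivAt ψ1 (ψ2 x) x) (B : ℝ)
    (hB : ∀ x, |ψ x| ≤ B ∧ |ψ1 x| ≤ B ∧ |ψ2 x| ≤ B)
    (φ θ : ℝ → ℝ) (hθ : Continuous θ) (hφ : ∀ t, HasDerivAt φ (θ t) t) (δ : ℝ)
    (hδ : ∀ t ∈ Set.Icc (0:ℝ) T, |φ t| ≤ δ) :
    |∫ t in Set.Icc 0 T, θ t * ∫ p, ψ p.1 ∂(m t)| ≤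
      (2 * B + (C0 * B + C0 ^ 2 / 2 * B) * ∫ t in Set.Icc 0 T, (m t Set.univ).toReal) * δ := by
  obtain ⟨hμ, hμs, hV, hFP⟩ := hR
  have hφc : Continuous φ := continuous_iff_continuousAt.2 fun t => (hφ t).continuousAt
  have h0c : Continuous ψ := continuous_iff_continuousAt.2 fun t => (hd1 t).continuousAt
  have h1c : Continuous ψ1 := continuous_iff_continuousAt.2 fun t => (hd2 t).continuousAt
  have hδ0 : 0 ≤ δ := (abs_nonneg _).trans (hδ 0 ⟨le_rfl, hT.le⟩)
  have hB0 : 0 ≤ B := (abs_nonneg _).trans (hB 0).1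
  have hC00 : 0 ≤ C0 := (abs_nonneg _).trans (hC0 0 0 0).1
  obtain ⟨D, hD⟩ := isCompact_Icc.exists_bound_of_continuousOn (s := Set.Icc (0:ℝ) T)
    hθ.continuousOn
  have hD0 : 0 ≤ D := (norm_nonneg _).trans (hD 0 ⟨le_rfl, hT.le⟩)
  have hcb : IsCb12 T O (fun t x => φ t * ψ x) (fun t x => θ t * ψ x) (fun t x => φ t * ψ1 x)
      (fun t x => φ t * ψ2 x) := by
    refine ⟨by fun_prop, by fun_prop, by fun_prop, by fun_prop, ?_, ?_, ?_, ?_⟩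
    · intro t _ x _
      exact ((hφ t).mul_const (ψ x)).hasDerivWithinAt
    · intro t _ x _
      exact ((hd1 x).const_mul (φ t)).hasDerivWithinAt
    · intro t _ x _
      exact ((hd2 x).const_mul (φ t)).hasDerivWithinAt
    · refine ⟨(δ + D) * B, fun t ht x _ => ?_⟩
      have e1 : |φ t| ≤ δ + D := by linarith [hδ t ht]
      have e2 : |θ t| ≤ δ + D := by have := hD t ht; rw [Real.norm_eq_abs] at this; linarith
      have := hB x
      simp only [abs_mul]
      refine ⟨?_, ?_, ?_, ?_⟩ <;> gcongr <;> tauto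
  have hmain := hFP _ _ _ _ hcb
  set Lψ : ℝ → ℝ × ℝ → ℝ := fun t p => b t p.1 p.2 * ψ1 p.1 + σ t p.1 p.2 ^ 2 / 2 * ψ2 p.1 with hLψ
  have hLm : Measurable (fun q : ℝ × (ℝ × ℝ) => Lψ q.1 q.2) := by
    have m1 : Measurable ψ1 := h1c.measurable
    have m2 : Measurable ψ2 := h2c.measurable
    simp only [hLψ]
    exact (hb.mul (m1.comp (by fun_prop))).add
      (((hσ.pow_const 2).div_const 2).mul (m2.comp (by fun_prop)))
  have hLb : ∀ t p, |Lψ t p| ≤ C0 * B + C0 ^ 2 / 2 * B := by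
    intro t p
    simp only [hLψ]
    refine (abs_add_le _ _).trans ?_
    have e1 : |σ t p.1 p.2 ^ 2 / 2| ≤ C0 ^ 2 / 2 := by
      rw [abs_of_nonneg (by positivity), ← sq_abs]
      have := (hC0 t p.1 p.2).2
      gcongr
    rw [abs_mul, abs_mul]
    have := hB p.1
    have := (hC0 t p.1 p.2).1
    gcongr <;> tauto
  have hψi : ∀ t, Integrable (fun p : ℝ × ℝ => ψ p.1) (m t) := fun t =>
    int_bdd hV _ (h0c.measurable.comp measurable_fst) B (fun p => (hB p.1).1) t
  have hLi : ∀ t, Integrable (Lψ t) (m t) := fun t =>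
    int_bdd hV _ (hLm.comp measurable_prodMk_left) _ (hLb t) t
  have hinner : ∀ t, (∫ p, (θ t * ψ p.1 + (b t p.1 p.2 * (φ t * ψ1 p.1)
      + σ t p.1 p.2 ^ 2 / 2 * (φ t * ψ2 p.1))) ∂(m t)) =
      θ t * (∫ p, ψ p.1 ∂(m t)) + φ t * ∫ p, Lψ t p ∂(m t) := by
    intro t
    rw [← integral_const_mul, ← integral_const_mul,
      ← integral_add ((hψi t).const_mul _) ((hLi t).const_mul _)]
    congr 1; ext p; simp only [hLψ]; ring
  simp only [hinner] at hmain
  have hI1 : IntegrableOn (fun t => θ t * ∫ p, ψ p.1 ∂(m t)) (Set.Icc 0 T) := by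
    have := intOn_int hV (fun _ p => ψ p.1) (h0c.measurable.comp (by fun_prop)) B
      (fun _ p => (hB p.1).1)
    refine Integrable.bdd_mul (c := D) this hθ.aestronglyMeasurable ?_
    exact (ae_restrict_iff' measurableSet_Icc).2 (Eventually.of_forall hD)
  have hI2 : IntegrableOn (fun t => φ t * ∫ p, Lψ t p ∂(m t)) (Set.Icc 0 T) := by
    have := intOn_int hV Lψ hLm _ hLb
    refine Integrable.bdd_mul (c := δ) this hφc.aestronglyMeasurable ?_
    exact (ae_restrict_iff' measurableSet_Icc).2 (Eventually.of_forall hδ)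
  rw [integral_add hI1 hI2] at hmain
  have b1 : |∫ p, φ p.1 * ψ p.2 ∂μ| ≤ δ * B := by
    have := norm_integral_le_of_norm_le_const (μ := μ) (f := fun p : ℝ × ℝ => φ p.1 * ψ p.2)
      (C := δ * B) ?_
    · simpa using this
    · have hae : ∀ᵐ p ∂μ, p ∈ Set.Icc 0 T ×ˢ closure O := hμs
      filter_upwards [hae] with p hp
      rw [Real.norm_eq_abs, abs_mul]
      have := hδ p.1 hp.1
      have := (hB p.2).1
      gcongr
  have b2 : |∫ x, φ 0 * ψ x ∂m0| ≤ δ * B := by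
    have := norm_integral_le_of_norm_le_const (μ := m0) (f := fun x => φ 0 * ψ x)
      (C := δ * B) (Eventually.of_forall fun x => ?_)
    · simpa using this
    · rw [Real.norm_eq_abs, abs_mul]
      have := hδ 0 ⟨le_rfl, hT.le⟩
      have := (hB x).1
      gcongr
  have b3 : |∫ t in Set.Icc 0 T, φ t * ∫ p, Lψ t p ∂(m t)| ≤
      δ * ((C0 * B + C0 ^ 2 / 2 * B) * ∫ t in Set.Icc 0 T, (m t Set.univ).toReal) := by
    rw [← integral_const_mul, ← integral_const_mul, ← Real.norm_eq_abs]
    refine norm_integral_le_of_norm_le ((hV.2.2.2.const_mul _).const_mul _) ?_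
    refine (ae_restrict_iff' measurableSet_Icc).2 (Eventually.of_forall fun t ht => ?_)
    rw [Real.norm_eq_abs, abs_mul]
    have := hδ t ht
    have := bound_int hV (Lψ t) _ (hLb t) t
    gcongr
  have e : (∫ t in Set.Icc 0 T, θ t * ∫ p, ψ p.1 ∂(m t)) = (∫ p, φ p.1 * ψ p.2 ∂μ)
      - (∫ x, φ 0 * ψ x ∂m0) - ∫ t in Set.Icc 0 T, φ t * ∫ p, Lψ t p ∂(m t) := by
    linarith
  rw [e]
  refine (abs_sub _ _).trans ?_
  have := abs_sub (∫ p, φ p.1 * ψ p.2 ∂μ) (∫ x, φ 0 * ψ x ∂m0)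
  linarith

/-- The `L¹` convergence for time-independent smooth compactly supported functions. -/
lemma smooth_L1 {T : ℝ} (hT : 0 < T) {O A : Set ℝ} {b σ : ℝ → ℝ → ℝ → ℝ}
    (hbσ : CoefAssumption O A b σ) {m0 : Measure ℝ} (hm0 : InitAssumption O m0)
    {μn : ℕ → Measure (ℝ × ℝ)} {mn : ℕ → ℝ → Measure (ℝ × ℝ)} {m : ℝ → Measure (ℝ × ℝ)}
    (hRn : ∀ n, MemR T O A b σ m0 (μn n) (mn n))
    (hmV : MemV T O A m) (hconv : ConvV T mn m)
    (ψ : ℝ → ℝ) (hψ : ContDiff ℝ 2 ψ) (hψc : HasCompactSupport ψ) :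
    Tendsto (fun n => ∫ t in Set.Icc 0 T, |(∫ p, ψ p.1 ∂(mn n t)) - (∫ p, ψ p.1 ∂(m t))|)
      atTop (nhds 0) := by
  obtain ⟨hb, hσ, ⟨C0, hC0⟩, -, -, -, -⟩ := hbσ
  obtain ⟨hprob, -, -⟩ := hm0
  have hd1 : ∀ x, HasDerivAt ψ (deriv ψ x) x := fun x =>
    (hψ.differentiable (by norm_num) x).hasDerivAt
  have hψ1 : ContDiff ℝ 1 (deriv ψ) := ContDiff.deriv' (n := 1) (by simpa [one_add_one_eq_two] using hψ)
  have hd2 : ∀ x, HasDerivAt (deriv ψ) (deriv (deriv ψ) x) x := fun x =>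
    (hψ1.differentiable (by norm_num) x).hasDerivAt
  have h2c : Continuous (deriv (deriv ψ)) := hψ1.continuous_deriv (by norm_num)
  obtain ⟨B0, hB0⟩ := hψc.exists_bound_of_continuous hψ.continuous
  obtain ⟨B1, hB1⟩ := hψc.deriv.exists_bound_of_continuous hψ1.continuous
  obtain ⟨B2, hB2⟩ := hψc.deriv.deriv.exists_bound_of_continuous h2c
  have hB : ∀ x, |ψ x| ≤ max B0 (max B1 B2) ∧ |deriv ψ x| ≤ max B0 (max B1 B2) ∧
      |deriv (deriv ψ) x| ≤ max B0 (max B1 B2) := fun x =>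
    ⟨(hB0 x).trans (by simp), (hB1 x).trans (by simp), (hB2 x).trans (by simp)⟩
  set B := max B0 (max B1 B2)
  have hBn : 0 ≤ B := (abs_nonneg _).trans (hB 0).1
  have hC00 : 0 ≤ C0 := (abs_nonneg _).trans (hC0 0 0 0).1
  have hmass : Tendsto (fun n => ∫ t in Set.Icc 0 T, (mn n t Set.univ).toReal) atTop
      (nhds (∫ t in Set.Icc 0 T, (m t Set.univ).toReal)) := by
    simpa [Measure.real] using hconv (fun _ _ => 1) continuous_const ⟨1, fun _ _ => by simp⟩
  obtain ⟨M, hM⟩ := hmass.bddAbove_range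
  have hM' : ∀ n, ∫ t in Set.Icc 0 T, (mn n t Set.univ).toReal ≤ M := fun n => hM ⟨n, rfl⟩
  have hM0 : 0 ≤ M := (integral_nonneg fun t => ENNReal.toReal_nonneg).trans (hM' 0)
  have hψm : Measurable (fun q : ℝ × (ℝ × ℝ) => ψ q.2.1) :=
    hψ.continuous.measurable.comp (by fun_prop)
  refine BV_L1 T hT (fun n t => ∫ p, ψ p.1 ∂(mn n t)) (fun t => ∫ p, ψ p.1 ∂(m t))
    (fun n => intOn_int (hRn n).2.2.1 (fun _ p => ψ p.1) hψm B (fun _ p => (hB p.1).1))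
    (intOn_int hmV (fun _ p => ψ p.1) hψm B (fun _ p => (hB p.1).1))
    (2 * B + (C0 * B + C0 ^ 2 / 2 * B) * M) (by positivity) ?_ ?_
  · intro n φ θ hθ hφ δ hδ
    have hδ0 : 0 ≤ δ := (abs_nonneg _).trans (hδ 0 ⟨le_rfl, hT.le⟩)
    refine (FP_bound hT hb hσ C0 hC0 m0 (hRn n) ψ _ _ h2c hd1 hd2 B hB φ θ hθ hφ δ hδ).trans ?_
    have := hM' n
    gcongr
  · rintro θ hθ ⟨D, hD⟩
    have hD0 : 0 ≤ D := (abs_nonneg _).trans (hD 0)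
    have hψc := hψ.continuous
    have := hconv (fun t p => θ t * ψ p.1) (by fun_prop) ⟨D * B, fun t p => by
      rw [abs_mul]
      have := hD t
      have := (hB p.1).1
      gcongr⟩
    simpa only [integral_const_mul] using this

/-- Polynomial approximation on a compact subset of the plane. -/
lemma poly_approx (S : Set (ℝ × ℝ)) (hS : IsCompact S) (h : ℝ × ℝ → ℝ) (hh : ContinuousOn h S)
    (η : ℝ) (hη : 0 < η) :
    ∃ P : MvPolynomial (Fin 2) ℝ, ∀ q ∈ S, |MvPolynomial.eval ![q.1, q.2] P - h q| ≤ η := by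
  have : CompactSpace S := isCompact_iff_compactSpace.1 hS
  let X : Fin 2 → C(S, ℝ) := ![⟨fun q => q.1.1, by fun_prop⟩, ⟨fun q => q.1.2, by fun_prop⟩]
  let F : MvPolynomial (Fin 2) ℝ →ₐ[ℝ] C(S, ℝ) := MvPolynomial.aeval X
  have hF : ∀ P q, F P q = MvPolynomial.eval ![q.1.1, q.1.2] P := by
    intro P q
    induction P using MvPolynomial.induction_on with
    | C a => simp [F]
    | add p q hp hq => simp [hp, hq]
    | mul_X p i hp =>
      rw [map_mul, ContinuousMap.mul_apply, hp, map_mul]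
      fin_cases i <;> simp [F, X]
  have hsep : F.range.SeparatesPoints := by
    intro x y hxy
    by_cases h1 : x.1.1 = y.1.1
    · refine ⟨_, ⟨F (MvPolynomial.X 1), ⟨_, rfl⟩, rfl⟩, ?_⟩
      show F _ x ≠ F _ y
      rw [hF, hF]
      simp only [MvPolynomial.eval_X]
      intro h2
      exact hxy (Subtype.ext (Prod.ext h1 h2))
    · refine ⟨_, ⟨F (MvPolynomial.X 0), ⟨_, rfl⟩, rfl⟩, ?_⟩
      show F _ x ≠ F _ y
      rw [hF, hF]
      simpa using h1
  obtain ⟨⟨g, P, rfl⟩, hg⟩ :=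
    ContinuousMap.exists_mem_subalgebra_near_continuousMap_of_separatesPoints F.range hsep
      ⟨S.domRestrict h, continuousOn_iff_continuous_domRestrict.1 hh⟩ η hη
  refine ⟨P, fun q hq => ?_⟩
  have := (ContinuousMap.norm_coe_le_norm _ (⟨q, hq⟩ : S)).trans hg.le
  have h2 := hF P ⟨q, hq⟩
  simp only at h2
  rw [← h2]
  exact this

/-- Smooth cutoff functions. -/
def cut (k : ℕ) : ContDiffBump (0:ℝ) := ⟨(k:ℝ) + 1, (k:ℝ) + 2, by positivity, by linarith⟩

lemma tail_small {T : ℝ} {O A : Set ℝ} {m : ℝ → Measure (ℝ × ℝ)} (hm : MemV T O A m) :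
    Tendsto (fun k : ℕ => ∫ t in Set.Icc 0 T, ∫ p, (1 - cut k p.1) ∂(m t)) atTop (nhds 0) := by
  have hb : ∀ k (p : ℝ × ℝ), |1 - cut k p.1| ≤ 1 := fun k p => by
    rw [abs_of_nonneg (by linarith [(cut k).le_one (x := p.1)])]
    linarith [(cut k).nonneg (x := p.1)]
  have hc : ∀ k, Continuous (fun p : ℝ × ℝ => 1 - cut k p.1) := fun k =>
    continuous_const.sub ((cut k).continuous.comp continuous_fst)
  have h0 : (0:ℝ) = ∫ t in Set.Icc 0 T, (0:ℝ) := by simp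
  refine Tendsto.mono_right ?_ (le_of_eq (congrArg nhds h0.symm))
  refine tendsto_integral_of_dominated_convergence (fun t => (m t Set.univ).toReal) ?_ hm.2.2.2 ?_ ?_
  · intro k
    exact (meas_int m hm.1 hm.2.2.1 (fun _ p => 1 - cut k p.1)
      ((hc k).measurable.comp measurable_snd)).aestronglyMeasurable
  · intro k
    refine Eventually.of_forall fun t => ?_
    simpa using bound_int hm _ 1 (hb k) t
  · refine Eventually.of_forall fun t => ?_
    have : IsFiniteMeasure (m t) := ⟨hm.1 t⟩
    have h0 : (0:ℝ) = ∫ p, (0:ℝ) ∂(m t) := by simp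
    refine Tendsto.mono_right ?_ (le_of_eq (congrArg nhds h0.symm))
    refine tendsto_integral_of_dominated_convergence (fun _ => (1:ℝ))
      (fun k => (hc k).aestronglyMeasurable) (integrable_const _)
      (fun k => Eventually.of_forall (hb k)) (Eventually.of_forall fun p => ?_)
    obtain ⟨N, hN⟩ := exists_nat_ge |p.1|
    refine tendsto_const_nhds.congr' ?_
    filter_upwards [eventually_ge_atTop N] with k hk
    rw [(cut k).one_of_mem_closedBall, sub_self]
    rw [mem_closedBall_zero_iff, Real.norm_eq_abs]
    have : (N:ℝ) ≤ k := by exact_mod_cast hk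
    show |p.1| ≤ (k:ℝ) + 1
    linarith

/-- Pointwise-in-time approximation of `∫ h dm_t` by a polynomial with cutoff. -/
lemma approx_pt {T : ℝ} {O A : Set ℝ} {m : ℝ → Measure (ℝ × ℝ)} (hm : MemV T O A m)
    {h : ℝ → ℝ → ℝ}
    (hhc : ContinuousOn (fun p : ℝ × ℝ => h p.1 p.2) (Set.Icc 0 T ×ˢ closure O))
    {C : ℝ} (hhb : ∀ t ∈ Set.Icc (0:ℝ) T, ∀ x ∈ closure O, |h t x| ≤ C)
    (k : ℕ) {η : ℝ} (hη : 0 < η) (Q : ℝ → ℝ → ℝ) (hQc : ∀ t, Continuous (Q t))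
    (hQ : ∀ t ∈ Set.Icc (0:ℝ) T, ∀ x ∈ closure O, |x| ≤ (k:ℝ) + 2 → |Q t x - h t x| ≤ η)
    (t : ℝ) (ht : t ∈ Set.Icc (0:ℝ) T) :
    |(∫ p, h t p.1 ∂(m t)) - ∫ p, Q t p.1 * cut k p.1 ∂(m t)| ≤
      C * (∫ p, (1 - cut k p.1) ∂(m t)) + η * (m t Set.univ).toReal := by
  have : IsFiniteMeasure (m t) := ⟨hm.1 t⟩
  have hae : ∀ᵐ p ∂(m t), p ∈ closure O ×ˢ A := hm.2.1 t
  have hae' : ∀ᵐ p ∂(m t), p ∈ closure O ×ˢ (Set.univ : Set ℝ) := by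
    filter_upwards [hae] with p hp using ⟨hp.1, trivial⟩
  have hmeas : AEStronglyMeasurable (fun p : ℝ × ℝ => h t p.1) (m t) := by
    rw [← Measure.restrict_eq_self_of_ae_mem hae']
    refine ContinuousOn.aestronglyMeasurable ?_ (isClosed_closure.measurableSet.prod .univ)
    refine hhc.comp (f := fun p : ℝ × ℝ => (t, p.1)) (by fun_prop) ?_
    intro p hp
    exact ⟨ht, hp.1⟩
  have hi1 : Integrable (fun p : ℝ × ℝ => h t p.1) (m t) := by
    refine Integrable.of_bound hmeas C ?_
    filter_upwards [hae] with p hp using hhb t ht _ hp.1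
  have hcc : Continuous (fun x => Q t x * cut k x) := (hQc t).mul (cut k).continuous
  have hcs : HasCompactSupport (fun x => Q t x * cut k x) :=
    (cut k).hasCompactSupport.mul_left
  obtain ⟨D, hD⟩ := hcs.exists_bound_of_continuous hcc
  have hi2 : Integrable (fun p : ℝ × ℝ => Q t p.1 * cut k p.1) (m t) :=
    int_bdd hm _ (hcc.comp continuous_fst).measurable D (fun p => hD p.1) t
  have hi3 : Integrable (fun p : ℝ × ℝ => 1 - cut k p.1) (m t) := by
    refine int_bdd hm (fun p : ℝ × ℝ => 1 - cut k p.1) (continuous_const.sub ((cut k).continuous.comp continuous_fst)).measurable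
      1 (fun p => ?_) t
    rw [abs_of_nonneg (by linarith [(cut k).le_one (x := p.1)])]
    linarith [(cut k).nonneg (x := p.1)]
  rw [← integral_sub hi1 hi2]
  have hr : C * (∫ p, (1 - cut k p.1) ∂(m t)) + η * (m t Set.univ).toReal =
      ∫ p, (C * (1 - cut k p.1) + η) ∂(m t) := by
    rw [integral_add (hi3.const_mul C) (integrable_const _), integral_const_mul]
    simp [Measure.real, mul_comm]
  rw [hr, ← Real.norm_eq_abs]
  refine norm_integral_le_of_norm_le ((hi3.const_mul C).add (integrable_const _)) ?_
  filter_upwards [hae] with p hp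
  rw [Real.norm_eq_abs]
  have c0 := (cut k).nonneg (x := p.1)
  have c1 := (cut k).le_one (x := p.1)
  have hC := hhb t ht _ hp.1
  have e : h t p.1 - Q t p.1 * cut k p.1 =
      h t p.1 * (1 - cut k p.1) - (Q t p.1 - h t p.1) * cut k p.1 := by ring
  rw [e]
  refine (abs_sub _ _).trans ?_
  rw [abs_mul, abs_mul, abs_of_nonneg c0, abs_of_nonneg (sub_nonneg.2 c1)]
  have a1 : |h t p.1| * (1 - cut k p.1) ≤ C * (1 - cut k p.1) :=
    mul_le_mul_of_nonneg_right hC (sub_nonneg.2 c1)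
  have a2 : |Q t p.1 - h t p.1| * cut k p.1 ≤ η := by
    by_cases hk : |p.1| ≤ (k:ℝ) + 2
    · have := hQ t ht _ hp.1 hk
      nlinarith [abs_nonneg (Q t p.1 - h t p.1)]
    · rw [(cut k).zero_of_le_dist, mul_zero]
      · exact hη.le
      · rw [dist_zero_right, Real.norm_eq_abs]
        exact (not_le.1 hk).le
  linarith

/-- The integral of a cutoff polynomial as a finite combination. -/
lemma poly_int {T : ℝ} {O A : Set ℝ} {m : ℝ → Measure (ℝ × ℝ)} (hm : MemV T O A m)
    (P : MvPolynomial (Fin 2) ℝ) (k : ℕ) (t : ℝ) :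
    ∫ p, MvPolynomial.eval ![t, p.1] P * cut k p.1 ∂(m t) =
      ∑ d ∈ P.support, MvPolynomial.coeff d P * t ^ d 0 * ∫ p, p.1 ^ d 1 * cut k p.1 ∂(m t) := by
  have e : ∀ p : ℝ × ℝ, MvPolynomial.eval ![t, p.1] P * cut k p.1 =
      ∑ d ∈ P.support, MvPolynomial.coeff d P * t ^ d 0 * (p.1 ^ d 1 * cut k p.1) := by
    intro p
    rw [MvPolynomial.eval_eq', Finset.sum_mul]
    refine Finset.sum_congr rfl fun d _ => ?_
    simp [Fin.prod_univ_two]; ring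
  simp only [e]
  rw [integral_finsetSum]
  · simp only [integral_const_mul]
  · intro d _
    refine Integrable.const_mul ?_ _
    have hcc : Continuous (fun x : ℝ => x ^ d 1 * cut k x) := (by fun_prop : Continuous (fun x : ℝ => x ^ d 1)).mul (cut k).continuous
    have hcs : HasCompactSupport (fun x : ℝ => x ^ d 1 * cut k x) :=
      (cut k).hasCompactSupport.mul_left
    obtain ⟨D, hD⟩ := hcs.exists_bound_of_continuous hcc
    exact int_bdd hm _ (hcc.comp continuous_fst).measurable D (fun p => hD p.1) t

/-- An L¹ convergence result: if `h : [0,T]×Ō → ℝ` is bounded and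
continuous, `(μⁿ, mⁿ) ⊆ R` and `mⁿ → m` in `V` (with `m ∈ V`), then
`t ↦ ∫ h(t,x) m_tⁿ(dx,da)` converges to `t ↦ ∫ h(t,x) m_t(dx,da)` in `L¹([0,T])`. -/
theorem L1_convergence_of_memR
    (T : ℝ) (hT : 0 < T) (O A : Set ℝ) (hO : IsOpen O) (hA : IsCompact A)
    (b σ : ℝ → ℝ → ℝ → ℝ) (hbσ : CoefAssumption O A b σ)
    (m0 : Measure ℝ) (hm0 : InitAssumption O m0)
    (h : ℝ → ℝ → ℝ)
    (hhc : ContinuousOn (fun p : ℝ × ℝ => h p.1 p.2) (Set.Icc 0 T ×ˢ closure O))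
    (hhb : ∃ C : ℝ, ∀ t ∈ Set.Icc (0:ℝ) T, ∀ x ∈ closure O, |h t x| ≤ C)
    (μn : ℕ → Measure (ℝ × ℝ)) (mn : ℕ → ℝ → Measure (ℝ × ℝ))
    (m : ℝ → Measure (ℝ × ℝ))
    (hRn : ∀ n, MemR T O A b σ m0 (μn n) (mn n))
    (hmV : MemV T O A m) (hconv : ConvV T mn m) :
    Tendsto
      (fun n => ∫ t in Set.Icc 0 T, |(∫ p, h t p.1 ∂(mn n t)) - (∫ p, h t p.1 ∂(m t))|)
      atTop (nhds 0) := by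

  obtain ⟨C, hC⟩ := hhb
  have hC0 : 0 ≤ |C| := abs_nonneg C
  have hC' : ∀ t ∈ Set.Icc (0:ℝ) T, ∀ x ∈ closure O, |h t x| ≤ |C| :=
    fun t ht x hx => (hC t ht x hx).trans (le_abs_self C)
  have hVn : ∀ n, MemV T O A (mn n) := fun n => (hRn n).2.2.1
  set M := ∫ t in Set.Icc 0 T, (m t Set.univ).toReal with hM
  have hM0 : 0 ≤ M := integral_nonneg fun t => ENNReal.toReal_nonneg
  have hmass : Tendsto (fun n => ∫ t in Set.Icc 0 T, (mn n t Set.univ).toReal) atTop (nhds M) := by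
    simpa [Measure.real] using hconv (fun _ _ => 1) continuous_const ⟨1, fun _ _ => by simp⟩
  rw [Metric.tendsto_nhds]
  intro ε hε
  -- choice of the cutoff
  obtain ⟨k, hk⟩ : ∃ k : ℕ, 2 * |C| * (∫ t in Set.Icc 0 T, ∫ p, (1 - cut k p.1) ∂(m t)) < ε / 2 := by
    have h1 := (tail_small hmV).const_mul (2 * |C|)
    rw [mul_zero] at h1
    exact (h1.eventually (gt_mem_nhds (by positivity : (0:ℝ) < ε / 2))).exists
  set D := ∫ t in Set.Icc 0 T, ∫ p, (1 - cut k p.1) ∂(m t) with hD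
  -- choice of the polynomial
  set η := ε / (4 * (M + 1)) with hη
  have hη0 : 0 < η := by positivity
  have hS : IsCompact (Set.Icc 0 T ×ˢ (closure O ∩ Set.Icc (-((k:ℝ) + 2)) ((k:ℝ) + 2))) :=
    isCompact_Icc.prod (isCompact_Icc.inter_left isClosed_closure)
  obtain ⟨P, hP⟩ := poly_approx _ hS _
    (hhc.mono (Set.prod_mono_right Set.inter_subset_left)) η hη0
  have hQc : ∀ t, Continuous (fun x => MvPolynomial.eval ![t, x] P) := by
    intro t
    simp only [MvPolynomial.eval_eq', Fin.prod_univ_two]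
    simp only [Matrix.cons_val_zero, Matrix.cons_val_one]
    fun_prop
  have hQ : ∀ t ∈ Set.Icc (0:ℝ) T, ∀ x ∈ closure O, |x| ≤ (k:ℝ) + 2 →
      |MvPolynomial.eval ![t, x] P - h t x| ≤ η :=
    fun t ht x hx hxk => hP (t, x) ⟨ht, hx, abs_le.1 hxk⟩
  -- tails
  have hcutc : Continuous (fun q : ℝ × ℝ × ℝ => 1 - cut k q.2.1) :=
    continuous_const.sub ((cut k).continuous.comp (by fun_prop))
  have hcutb : ∀ p : ℝ × ℝ, |1 - cut k p.1| ≤ 1 := fun p => by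
    rw [abs_of_nonneg (by linarith [(cut k).le_one (x := p.1)])]
    linarith [(cut k).nonneg (x := p.1)]
  have htail : Tendsto (fun n => ∫ t in Set.Icc 0 T, ∫ p, (1 - cut k p.1) ∂(mn n t)) atTop
      (nhds D) := hconv (fun _ p => 1 - cut k p.1) hcutc ⟨1, fun _ p => hcutb p⟩
  -- smooth pieces
  have hsm : ∀ j : ℕ, ContDiff ℝ 2 (fun x : ℝ => x ^ j * cut k x) := fun j =>
    (contDiff_id.pow j).mul ((cut k).contDiff (n := 2))
  have hcs : ∀ j : ℕ, HasCompactSupport (fun x : ℝ => x ^ j * cut k x) := fun j =>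
    (cut k).hasCompactSupport.mul_left
  have hint : ∀ (m' : ℝ → Measure (ℝ × ℝ)), MemV T O A m' → ∀ j : ℕ,
      IntegrableOn (fun t => ∫ p, p.1 ^ j * cut k p.1 ∂(m' t)) (Set.Icc 0 T) := by
    intro m' hm' j
    obtain ⟨E, hE⟩ := (hcs j).exists_bound_of_continuous (hsm j).continuous
    exact intOn_int hm' (fun _ p => p.1 ^ j * cut k p.1)
      ((hsm j).continuous.measurable.comp (by fun_prop)) E (fun _ p => hE p.1)
  have hintc : ∀ (m' : ℝ → Measure (ℝ × ℝ)), MemV T O A m' →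
      IntegrableOn (fun t => ∫ p, (1 - cut k p.1) ∂(m' t)) (Set.Icc 0 T) := fun m' hm' =>
    intOn_int hm' (fun _ p => 1 - cut k p.1) hcutc.measurable 1 (fun _ p => hcutb p)
  let g : ℕ → ℕ → ℝ → ℝ := fun n j t =>
    |(∫ p, p.1 ^ j * cut k p.1 ∂(mn n t)) - ∫ p, p.1 ^ j * cut k p.1 ∂(m t)|
  have hg : ∀ j, Tendsto (fun n => ∫ t in Set.Icc 0 T, g n j t) atTop (nhds 0) := fun j =>
    smooth_L1 hT hbσ hm0 hRn hmV hconv _ (hsm j) (hcs j)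
  have hgi : ∀ n j, IntegrableOn (g n j) (Set.Icc 0 T) := fun n j =>
    ((hint _ (hVn n) j).sub (hint _ hmV j)).abs
  -- the upper bound
  let R : ℕ → ℝ := fun n =>
    (|C| * (∫ t in Set.Icc 0 T, ∫ p, (1 - cut k p.1) ∂(mn n t))
      + η * ∫ t in Set.Icc 0 T, (mn n t Set.univ).toReal) + (|C| * D + η * M)
      + ∑ d ∈ P.support, |MvPolynomial.coeff d P| * T ^ d 0 * ∫ t in Set.Icc 0 T, g n (d 1) t
  have hR : Tendsto R atTop (nhds ((|C| * D + η * M) + (|C| * D + η * M) +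
      ∑ d ∈ P.support, |MvPolynomial.coeff d P| * T ^ d 0 * 0)) := by
    refine (((htail.const_mul _).add (hmass.const_mul _)).add tendsto_const_nhds).add ?_
    exact tendsto_finsetSum _ fun d _ => (hg (d 1)).const_mul _
  have hlim : (|C| * D + η * M) + (|C| * D + η * M) +
      ∑ d ∈ P.support, |MvPolynomial.coeff d P| * T ^ d 0 * 0 < ε := by
    have : η * M ≤ ε / 4 := by
      have e : η * M = ε / 4 * (M / (M + 1)) := by rw [hη]; field_simp
      rw [e]
      have : M / (M + 1) ≤ 1 := by rw [div_le_one (by linarith)]; linarith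
      nlinarith
    simp only [mul_zero, Finset.sum_const_zero]
    linarith
  filter_upwards [hR.eventually (gt_mem_nhds hlim)] with n hn
  rw [Real.dist_eq, sub_zero, abs_of_nonneg (integral_nonneg fun t => abs_nonneg _)]
  refine lt_of_le_of_lt ?_ hn
  have ha : ∀ (m' : ℝ → Measure (ℝ × ℝ)), MemV T O A m' →
      IntegrableOn (fun t => |C| * (∫ p, (1 - cut k p.1) ∂(m' t)) + η * (m' t Set.univ).toReal)
        (Set.Icc 0 T) := fun m' hm' =>
    ((hintc m' hm').const_mul _).add (hm'.2.2.2.const_mul _)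
  have hsi : IntegrableOn (fun t => ∑ d ∈ P.support,
      |MvPolynomial.coeff d P| * T ^ d 0 * g n (d 1) t) (Set.Icc 0 T) :=
    integrable_finsetSum _ fun d _ => (hgi n (d 1)).const_mul _
  have haa : IntegrableOn (fun t =>
      (|C| * (∫ p, (1 - cut k p.1) ∂(mn n t)) + η * (mn n t Set.univ).toReal)
      + (|C| * (∫ p, (1 - cut k p.1) ∂(m t)) + η * (m t Set.univ).toReal)) (Set.Icc 0 T) :=
    (ha _ (hVn n)).add (ha _ hmV)
  have hRn' : R n = ∫ t in Set.Icc 0 T,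
      ((|C| * (∫ p, (1 - cut k p.1) ∂(mn n t)) + η * (mn n t Set.univ).toReal)
      + (|C| * (∫ p, (1 - cut k p.1) ∂(m t)) + η * (m t Set.univ).toReal)
      + ∑ d ∈ P.support, |MvPolynomial.coeff d P| * T ^ d 0 * g n (d 1) t) := by
    rw [integral_add haa hsi, integral_add (ha _ (hVn n)) (ha _ hmV),
      integral_add ((hintc _ (hVn n)).const_mul _) ((hVn n).2.2.2.const_mul _),
      integral_add ((hintc _ hmV).const_mul _) (hmV.2.2.2.const_mul _),
      integral_finsetSum _ fun d _ => (hgi n (d 1)).const_mul _]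
    simp only [integral_const_mul]
    rfl
  rw [hRn']
  refine integral_mono_of_nonneg (Eventually.of_forall fun t => abs_nonneg _) (haa.add hsi) ?_
  refine (ae_restrict_iff' measurableSet_Icc).2 (Eventually.of_forall fun t ht => ?_)
  have a1 := approx_pt (hVn n) hhc hC' k hη0 _ hQc hQ t ht
  have a2 := approx_pt hmV hhc hC' k hη0 _ hQc hQ t ht
  have a3 : |(∫ p, MvPolynomial.eval ![t, p.1] P * cut k p.1 ∂(mn n t)) -
      ∫ p, MvPolynomial.eval ![t, p.1] P * cut k p.1 ∂(m t)| ≤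
      ∑ d ∈ P.support, |MvPolynomial.coeff d P| * T ^ d 0 * g n (d 1) t := by
    rw [poly_int (hVn n), poly_int hmV, ← Finset.sum_sub_distrib]
    refine (Finset.abs_sum_le_sum_abs _ _).trans (Finset.sum_le_sum fun d _ => ?_)
    rw [← mul_sub, abs_mul, abs_mul, abs_pow, abs_of_nonneg ht.1]
    have := ht.2
    have := ht.1
    gcongr
  show |(∫ p, h t p.1 ∂(mn n t)) - (∫ p, h t p.1 ∂(m t))| ≤ _
  rw [abs_le] at a1 a2 a3 ⊢
  constructor <;> linarith [a1.1, a1.2, a2.1, a2.2, a3.1, a3.2]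
end
end

section
/- Compactness of the constraint set: the set R is a compact subset of P([0,T]×Ō) × V, where P([0,T]×Ō) carries the topology of weak convergence of probability measures and V the topology of weak convergence of the associated finite measures m_t(dx,da)dt. Equivalently, every sequence (μⁿ, mⁿ)_{n≥1} ⊆ R admits a subsequence (μ^{n_k}, m^{n_k}) and an element (μ, m) ∈ R such that μ^{n_k} converges weakly to μ and m^{n_k} → m in V. -/
open MeasureTheory Filter Set Topology

noncomputable section

theorem aux_measure_le {α β : Measure ℝ} [IsFiniteMeasure α] [IsFiniteMeasure β]
    (h : ∀ ψ : ℝ → ℝ, Continuous ψ → (∀ x, 0 ≤ ψ x) → (∃ C, ∀ x, |ψ x| ≤ C) →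
      ∫ x, ψ x ∂α ≤ ∫ x, ψ x ∂β) : α ≤ β := by
  have hclosed : ∀ F : Set ℝ, IsClosed F → α F ≤ β F := by
    intro F hF
    have hδ : ∀ n : ℕ, (0:ℝ) < 1 / ((n:ℝ) + 1) := fun n => by positivity
    have h1 := tendsto_lintegral_thickenedIndicator_of_isClosed β hF hδ
      tendsto_one_div_add_atTop_nhds_zero_nat
    refine ge_of_tendsto' h1 fun n => ?_
    refine (measure_le_lintegral_thickenedIndicator α hF.measurableSet (hδ n)).trans ?_
    have hc : Continuous fun x => ((thickenedIndicator (hδ n) F x : NNReal) : ℝ) :=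
      NNReal.continuous_coe.comp (thickenedIndicator (hδ n) F).continuous
    have hb : ∀ x, |((thickenedIndicator (hδ n) F x : NNReal) : ℝ)| ≤ 1 := by
      intro x
      rw [abs_of_nonneg (NNReal.coe_nonneg _)]
      exact_mod_cast thickenedIndicator_le_one (hδ n) F x
    have key := h _ hc (fun x => NNReal.coe_nonneg _) ⟨1, hb⟩
    have conv : ∀ (γ : Measure ℝ) [IsFiniteMeasure γ],
        ∫⁻ x, (thickenedIndicator (hδ n) F x : ENNReal) ∂γ
          = ENNReal.ofReal (∫ x, ((thickenedIndicator (hδ n) F x : NNReal) : ℝ) ∂γ) := by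
      intro γ _
      rw [ofReal_integral_eq_lintegral_ofReal]
      · simp
      · exact Integrable.of_bound hc.aestronglyMeasurable 1 (ae_of_all _ fun x => by simpa using hb x)
      · exact ae_of_all _ fun x => NNReal.coe_nonneg _
    rw [conv α, conv β]
    exact ENNReal.ofReal_le_ofReal key
  refine Measure.le_iff.2 fun s hs => ?_
  rw [hs.measure_eq_iSup_isClosed_of_ne_top (measure_ne_top α s)]
  refine iSup_le fun F => iSup_le fun hFs => iSup_le fun hF => ?_
  exact (hclosed F hF).trans (measure_mono hFs)

theorem aux_measurable_CK {K : Set (ℝ × ℝ)} [CompactSpace K] (f : ℝ → C(K, ℝ))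
    (hf : ∀ q : K, Measurable fun t => f t q) : StronglyMeasurable f := by
  let : MeasurableSpace C(K, ℝ) := borel _
  have : BorelSpace C(K, ℝ) := ⟨rfl⟩
  have hdist : ∀ g : C(K, ℝ), Measurable fun t => dist (f t) g := by
    intro g
    refine measurable_of_Iic fun r => ?_
    by_cases hr : r < 0
    · convert MeasurableSet.empty
      ext t
      simp only [mem_preimage, mem_Iic, mem_empty_iff_false, iff_false, not_le]
      exact hr.trans_le dist_nonneg
    · push Not at hr
      have hD := TopologicalSpace.exists_countable_dense K
      obtain ⟨D, hDc, hDd⟩ := hD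
      have : (fun t => dist (f t) g) ⁻¹' Iic r = ⋂ q ∈ D, {t | dist (f t q) (g q) ≤ r} := by
        ext t
        simp only [mem_preimage, mem_Iic, mem_iInter, mem_ofPred_eq]
        rw [ContinuousMap.dist_le hr]
        constructor
        · intro h q _; exact h q
        · intro h q
          have hcl : IsClosed {q : K | dist (f t q) (g q) ≤ r} :=
            isClosed_le ((f t).continuous.dist g.continuous) continuous_const
          have : closure D ⊆ {q : K | dist (f t q) (g q) ≤ r} :=
            hcl.closure_subset_iff.2 fun q hq => h q hq
          exact this (hDd q)
      rw [this]
      refine MeasurableSet.biInter hDc fun q _ => ?_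
      exact measurableSet_le ((hf q).dist measurable_const) measurable_const
  refine Measurable.stronglyMeasurable ?_
  refine measurable_of_isOpen fun U hU => ?_
  obtain ⟨D, hDc, hDd⟩ := TopologicalSpace.exists_countable_dense C(K, ℝ)
  have : f ⁻¹' U = ⋃ g ∈ D, ⋃ r ∈ {r : ℚ | Metric.ball g (r:ℝ) ⊆ U},
      {t | dist (f t) g < r} := by
    ext t
    simp only [mem_preimage, mem_iUnion, mem_ofPred_eq, exists_prop]
    constructor
    · intro ht
      obtain ⟨ε, hε, hb⟩ := Metric.isOpen_iff.1 hU _ ht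
      obtain ⟨g, hgD, hg⟩ := hDd.exists_dist_lt (f t) (half_pos hε)
      obtain ⟨r, hr1, hr2⟩ := exists_rat_btwn hg
      refine ⟨g, hgD, r, ?_, hr1⟩
      intro y hy
      apply hb
      rw [Metric.mem_ball] at hy ⊢
      calc dist y (f t) ≤ dist y g + dist (f t) g := dist_triangle_right _ _ _
        _ < ε := by linarith
    · rintro ⟨g, _, r, hr, h⟩
      exact hr h
  rw [this]
  refine MeasurableSet.biUnion hDc fun g _ => ?_
  refine MeasurableSet.biUnion (Set.to_countable _) fun r _ => ?_
  exact measurableSet_lt (hdist g) measurable_const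

theorem aux_estimate {lam : Measure ℝ} [IsFiniteMeasure lam] (ρ : Measure (ℝ × ℝ × ℝ)) [IsFiniteMeasure ρ]
    (hρ : ρ.map Prod.fst ≤ lam) {F h : ℝ × ℝ × ℝ → ℝ} (hF : Measurable F) (hh : Continuous h)
    {C : ℝ} (hFC : ∀ q, |F q| ≤ C) (hhC : ∀ q, |h q| ≤ C)
    {K : Set (ℝ × ℝ)} (hK : MeasurableSet K) {g : ℝ → ℝ} (hg : Integrable g lam) (hg0 : ∀ t, 0 ≤ g t)
    (hFh : ∀ t, ∀ p ∈ K, |F (t, p) - h (t, p)| ≤ g t) {ε : ℝ} (hρK : ρ.real (Prod.snd ⁻¹' Kᶜ) ≤ ε) :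
    |∫ q, F q ∂ρ - ∫ q, h q ∂ρ| ≤ ∫ t, g t ∂lam + 2 * C * ε := by
  have hC : 0 ≤ C := (abs_nonneg _).trans (hFC 0)
  have iF : Integrable F ρ :=
    Integrable.of_bound hF.aestronglyMeasurable C (ae_of_all _ fun q => by simpa using hFC q)
  have ih : Integrable h ρ :=
    Integrable.of_bound hh.aestronglyMeasurable C (ae_of_all _ fun q => by simpa using hhC q)
  have hSm : MeasurableSet (Prod.snd ⁻¹' Kᶜ : Set (ℝ × ℝ × ℝ)) := measurable_snd hK.compl
  have ig' : Integrable g (ρ.map Prod.fst) := hg.mono_measure hρ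
  have ig : Integrable (fun q : ℝ × ℝ × ℝ => g q.1) ρ := ig'.comp_measurable measurable_fst
  have iI : Integrable ((Prod.snd ⁻¹' Kᶜ : Set (ℝ × ℝ × ℝ)).indicator (fun _ => 2 * C)) ρ :=
    (integrable_const _).indicator hSm
  rw [← integral_sub iF ih]
  refine (abs_integral_le_integral_abs).trans ?_
  calc ∫ q, |F q - h q| ∂ρ
      ≤ ∫ q, (g q.1 + (Prod.snd ⁻¹' Kᶜ : Set (ℝ × ℝ × ℝ)).indicator (fun _ => 2 * C) q) ∂ρ := by
        refine integral_mono (iF.sub ih).abs (ig.add iI) fun q => ?_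
        obtain ⟨t, p⟩ := q
        by_cases hp : p ∈ K
        · have : (t, p) ∉ (Prod.snd ⁻¹' Kᶜ : Set (ℝ × ℝ × ℝ)) := by simpa using hp
          simp only [Set.indicator_of_notMem this, add_zero]
          exact hFh t p hp
        · have : (t, p) ∈ (Prod.snd ⁻¹' Kᶜ : Set (ℝ × ℝ × ℝ)) := by simpa using hp
          simp only [Set.indicator_of_mem this]
          have := abs_sub (F (t, p)) (h (t, p))
          have h1 := hFC (t, p)
          have h2 := hhC (t, p)
          have h3 := hg0 t
          linarith
    _ = ∫ q, g q.1 ∂ρ + ρ.real (Prod.snd ⁻¹' Kᶜ) * (2 * C) := by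
        rw [integral_add ig iI, integral_indicator_const _ hSm, smul_eq_mul]
    _ ≤ ∫ t, g t ∂lam + 2 * C * ε := by
        have e1 : ∫ q, g q.1 ∂ρ = ∫ t, g t ∂(ρ.map Prod.fst) :=
          (integral_map measurable_fst.aemeasurable ig'.aestronglyMeasurable).symm
        have e2 : ∫ t, g t ∂(ρ.map Prod.fst) ≤ ∫ t, g t ∂lam :=
          integral_mono_measure hρ (ae_of_all _ hg0) hg
        have e3 : ρ.real (Prod.snd ⁻¹' Kᶜ) * (2 * C) ≤ 2 * C * ε := by
          rw [mul_comm]; exact mul_le_mul_of_nonneg_left hρK (by linarith)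
        linarith

theorem aux_stable {lam : Measure ℝ} [IsFiniteMeasure lam] (νn : ℕ → Measure (ℝ × ℝ × ℝ))
    (ν : Measure (ℝ × ℝ × ℝ)) [∀ n, IsFiniteMeasure (νn n)] [IsFiniteMeasure ν]
    (hνn : ∀ n, (νn n).map Prod.fst ≤ lam) (hν : ν.map Prod.fst ≤ lam)
    {S : Set (ℝ × ℝ)}
    (htight : ∀ ε : ℝ, 0 < ε → ∃ K ⊆ S, IsCompact K ∧ (∀ n, (νn n).real (Prod.snd ⁻¹' Kᶜ) ≤ ε)
      ∧ ν.real (Prod.snd ⁻¹' Kᶜ) ≤ ε)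
    (hw : ∀ h : ℝ × ℝ × ℝ → ℝ, Continuous h → (∃ C, ∀ q, |h q| ≤ C) →
      Tendsto (fun n => ∫ q, h q ∂(νn n)) atTop (𝓝 (∫ q, h q ∂ν)))
    {F : ℝ × ℝ × ℝ → ℝ} (hF : Measurable F) {C : ℝ} (hFC : ∀ q, |F q| ≤ C)
    (hFc : ∀ t, ContinuousOn (fun p => F (t, p)) S) :
    Tendsto (fun n => ∫ q, F q ∂(νn n)) atTop (𝓝 (∫ q, F q ∂ν)) := by
  have hC : 0 ≤ C := (abs_nonneg _).trans (hFC 0)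
  rw [Metric.tendsto_atTop]
  intro ε hε
  set δ : ℝ := ε / (4 * (1 + 2 * C)) with hδ
  have hδ0 : 0 < δ := by positivity
  obtain ⟨K, hKS, hK, hKn, hKν⟩ := htight δ hδ0
  have : CompactSpace K := isCompact_iff_compactSpace.1 hK
  let f : ℝ → C(K, ℝ) := fun t => ⟨fun p => F (t, p), ((hFc t).mono hKS).domRestrict⟩
  have hfm : StronglyMeasurable f := by
    refine aux_measurable_CK f fun q => ?_
    exact hF.comp (measurable_id.prodMk measurable_const)
  have hfi : Integrable f lam := by
    refine Integrable.of_bound hfm.aestronglyMeasurable C (ae_of_all _ fun t => ?_)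
    rw [ContinuousMap.norm_le _ hC]
    intro p
    exact hFC _
  obtain ⟨G, hG, hGi⟩ := hfi.exists_boundedContinuous_integral_sub_le hδ0
  let e : ℝ × K → ℝ × ℝ × ℝ := Prod.map id Subtype.val
  have he : IsClosedEmbedding e :=
    IsClosedEmbedding.id.prodMap hK.isClosed.isClosedEmbedding_subtypeVal
  let g0 : C(ℝ × K, ℝ) := ⟨fun q => G q.1 q.2, by fun_prop⟩
  obtain ⟨g1, hg1⟩ := ContinuousMap.exists_extension he g0
  let h : ℝ × ℝ × ℝ → ℝ := fun q => max (-C) (min C (g1 q))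
  have hh : Continuous h := by
    have := g1.continuous
    fun_prop
  have hhC : ∀ q, |h q| ≤ C := fun q => by
    rw [abs_le]
    exact ⟨le_max_left _ _, max_le (by linarith) (min_le_left _ _)⟩
  have hFh : ∀ t, ∀ p ∈ K, |F (t, p) - h (t, p)| ≤ ‖f t - G t‖ := by
    intro t p hp
    have e1 : g1 (t, p) = G t ⟨p, hp⟩ := by
      have := congrArg (fun k : C(ℝ × K, ℝ) => k (t, ⟨p, hp⟩)) hg1
      exact this
    have e2 : |F (t, p) - g1 (t, p)| ≤ ‖f t - G t‖ := by
      rw [e1]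
      exact (f t - G t).norm_coe_le_norm ⟨p, hp⟩
    refine le_trans ?_ e2
    have hb := abs_le.1 (hFC (t, p))
    show |F (t, p) - max (-C) (min C (g1 (t, p)))| ≤ _
    generalize F (t, p) = x at *
    generalize g1 (t, p) = y at *
    rcases le_total C y with h1 | h1
    · rw [min_eq_left h1, max_eq_right (by linarith), abs_of_nonpos (by linarith),
        abs_of_nonpos (by linarith)]
      linarith
    · rw [min_eq_right h1]
      rcases le_total (-C) y with h2 | h2
      · rw [max_eq_right h2]
      · rw [max_eq_left h2, abs_of_nonneg (by linarith), abs_of_nonneg (by linarith)]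
        linarith
  have hgi : Integrable (fun t => ‖f t - G t‖) lam := (hfi.sub hGi).norm
  have est : ∀ (ρ : Measure (ℝ × ℝ × ℝ)) [IsFiniteMeasure ρ], ρ.map Prod.fst ≤ lam →
      ρ.real (Prod.snd ⁻¹' Kᶜ) ≤ δ → |∫ q, F q ∂ρ - ∫ q, h q ∂ρ| ≤ ε / 4 := by
    intro ρ _ h1 h2
    refine (aux_estimate ρ h1 hF hh hFC hhC hK.measurableSet hgi (fun t => norm_nonneg _) hFh h2).trans ?_
    calc _ ≤ δ + 2 * C * δ := by linarith
      _ = δ * (1 + 2 * C) := by ring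
      _ = ε / 4 := by rw [hδ]; field_simp
  obtain ⟨N, hN⟩ := (Metric.tendsto_atTop.1 (hw h hh ⟨C, hhC⟩)) (ε / 4) (by positivity)
  refine ⟨N, fun n hn => ?_⟩
  have a1 := est (νn n) (hνn n) (hKn n)
  have a2 := est ν hν hKν
  have a3 := hN n hn
  rw [Real.dist_eq] at a3 ⊢
  rw [abs_le] at a1 a2
  rw [abs_lt] at a3 ⊢
  constructor <;> linarith

theorem aux_seq_compact_prob {E : Type*} [TopologicalSpace E] [TopologicalSpace.PseudoMetrizableSpace E]
    [TopologicalSpace.SeparableSpace E] [T2Space E] [MeasurableSpace E] [BorelSpace E]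
    (P : ℕ → Measure E) [hP : ∀ n, IsProbabilityMeasure (P n)]
    (ht : ∀ ε : ENNReal, 0 < ε → ∃ K : Set E, IsCompact K ∧ ∀ n, P n Kᶜ ≤ ε) :
    ∃ φ : ℕ → ℕ, StrictMono φ ∧ ∃ Q : Measure E, IsProbabilityMeasure Q ∧
      ∀ h : E → ℝ, Continuous h → (∃ C, ∀ q, |h q| ≤ C) →
        Tendsto (fun n => ∫ q, h q ∂(P (φ n))) atTop (𝓝 (∫ q, h q ∂Q)) := by
  let p : ℕ → ProbabilityMeasure E := fun n => ⟨P n, hP n⟩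
  have hc : IsCompact (closure (range p)) := by
    apply isCompact_closure_of_isTightMeasureSet
    rw [isTightMeasureSet_iff_exists_isCompact_measure_compl_le]
    intro ε hε
    obtain ⟨K, hK, h⟩ := ht ε hε
    refine ⟨K, hK, ?_⟩
    rintro _ ⟨_, ⟨n, rfl⟩, rfl⟩
    exact h n
  obtain ⟨q, -, φ, hφ, hlim⟩ := hc.tendsto_subseq (fun n => subset_closure (mem_range_self n))
  refine ⟨φ, hφ, (q : Measure E), q.2, fun h hh ⟨C, hC⟩ => ?_⟩
  rw [ProbabilityMeasure.tendsto_iff_forall_integral_tendsto] at hlim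
  exact hlim (BoundedContinuousFunction.ofNormedAddCommGroup h hh C (fun x => by simpa using hC x))

theorem aux_seq_compact_fin (νn : ℕ → Measure (ℝ × ℝ × ℝ)) {T : ℝ} (hT : 0 < T)
    (hmass : ∀ n, νn n univ ≤ ENNReal.ofReal T)
    (hsupp : ∀ n, νn n {q | q.1 < 0} = 0)
    (ht : ∀ ε : ENNReal, 0 < ε → ∃ K : Set (ℝ × ℝ × ℝ), IsCompact K ∧ ∀ n, νn n Kᶜ ≤ ε) :
    ∃ φ : ℕ → ℕ, StrictMono φ ∧ ∃ ν : Measure (ℝ × ℝ × ℝ), IsFiniteMeasure ν ∧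
      ∀ h : ℝ × ℝ × ℝ → ℝ, Continuous h → (∃ C, ∀ q, |h q| ≤ C) →
        Tendsto (fun n => ∫ q, h q ∂(νn (φ n))) atTop (𝓝 (∫ q, h q ∂ν)) := by
  have hfin : ∀ n, IsFiniteMeasure (νn n) := fun n => ⟨(hmass n).trans_lt ENNReal.ofReal_lt_top⟩
  let q0 : ℝ × ℝ × ℝ := (-1, 0, 0)
  let cT : ENNReal := ENNReal.ofReal T
  have hcT0 : cT ≠ 0 := by simpa [cT] using hT
  have hcT : cT ≠ ⊤ := ENNReal.ofReal_ne_top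
  let P : ℕ → Measure (ℝ × ℝ × ℝ) := fun n =>
    cT⁻¹ • (νn n + (cT - νn n univ) • Measure.dirac q0)
  have hP : ∀ n, IsProbabilityMeasure (P n) := by
    intro n
    constructor
    simp only [P, Measure.smul_apply, Measure.add_apply, measure_univ, smul_eq_mul, mul_one]
    rw [add_tsub_cancel_of_le (hmass n)]
    exact ENNReal.inv_mul_cancel hcT0 hcT
  have hPt : ∀ ε : ENNReal, 0 < ε → ∃ K : Set (ℝ × ℝ × ℝ), IsCompact K ∧ ∀ n, P n Kᶜ ≤ ε := by
    intro ε hε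
    obtain ⟨K, hK, h⟩ := ht (cT * ε) (by positivity)
    refine ⟨K ∪ {q0}, hK.union isCompact_singleton, fun n => ?_⟩
    have h1 : Measure.dirac q0 (K ∪ {q0})ᶜ = 0 := by
      rw [Measure.dirac_apply' _ (hK.union isCompact_singleton).isClosed.measurableSet.compl]
      simp
    have h2 : νn n (K ∪ {q0})ᶜ ≤ cT * ε :=
      (measure_mono (compl_subset_compl.2 subset_union_left)).trans (h n)
    simp only [P, Measure.smul_apply, Measure.add_apply, smul_eq_mul, h1, mul_zero, add_zero]
    calc cT⁻¹ * νn n (K ∪ {q0})ᶜ ≤ cT⁻¹ * (cT * ε) := by gcongr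
      _ = ε := by rw [← mul_assoc, ENNReal.inv_mul_cancel hcT0 hcT, one_mul]
  obtain ⟨φ, hφ, Q, hQ, hlim⟩ := aux_seq_compact_prob P hPt
  let χ : ℝ × ℝ × ℝ → ℝ := fun q => max 0 (min 1 (q.1 + 1))
  have hχc : Continuous χ := by fun_prop
  have hχ0 : ∀ q, 0 ≤ χ q := fun q => le_max_left _ _
  have hχ1 : ∀ q, χ q ≤ 1 := fun q => max_le zero_le_one (min_le_left _ _)
  have hχq0 : χ q0 = 0 := by simp [χ, q0]
  have hχp : ∀ q : ℝ × ℝ × ℝ, 0 ≤ q.1 → χ q = 1 := fun q hq => by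
    simp only [χ]; rw [min_eq_left (by linarith), max_eq_right zero_le_one]
  have hχT : ∀ q, 0 ≤ T * χ q := fun q => mul_nonneg hT.le (hχ0 q)
  let ν : Measure (ℝ × ℝ × ℝ) := Q.withDensity (fun q => ENNReal.ofReal (T * χ q))
  have hν : ∀ h : ℝ × ℝ × ℝ → ℝ, ∫ q, h q ∂ν = ∫ q, T * (χ q * h q) ∂Q := by
    intro h
    simp only [ν]
    rw [integral_withDensity_eq_integral_toReal_smul (by fun_prop) (by simp)]
    refine integral_congr_ae (ae_of_all _ fun q => ?_)
    simp only [ENNReal.toReal_ofReal (hχT q), smul_eq_mul, mul_assoc]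
  refine ⟨φ, hφ, ν, ?_, fun h hh ⟨C, hC⟩ => ?_⟩
  · refine isFiniteMeasure_withDensity_ofReal (Integrable.of_bound (by fun_prop) T (ae_of_all _ fun q => ?_)).2
    rw [Real.norm_of_nonneg (hχT q)]
    nlinarith [hχ1 q]
  · have hC0 : 0 ≤ C := (abs_nonneg _).trans (hC 0)
    have hbd : ∀ q, |χ q * h q| ≤ C := fun q => by
      rw [abs_mul, abs_of_nonneg (hχ0 q)]
      calc χ q * |h q| ≤ 1 * C := mul_le_mul (hχ1 q) (hC q) (abs_nonneg _) zero_le_one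
        _ = C := one_mul C
    have := (hlim (fun q => χ q * h q) (by fun_prop) ⟨C, hbd⟩).const_mul T
    rw [hν, integral_const_mul]
    refine this.congr fun n => ?_
    have i1 : ∀ (γ : Measure (ℝ × ℝ × ℝ)) [IsFiniteMeasure γ], Integrable (fun q => χ q * h q) γ :=
      fun γ _ => Integrable.of_bound (by fun_prop) C (ae_of_all _ fun q => by simpa using hbd q)
    simp only [P]
    have : IsFiniteMeasure ((cT - νn (φ n) univ) • Measure.dirac q0) :=
      Measure.smul_finite _ (ne_top_of_le_ne_top hcT tsub_le_self)
    rw [integral_smul_measure, integral_add_measure (i1 _) (i1 _), integral_smul_measure,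
      integral_dirac, hχq0, zero_mul, smul_zero, add_zero, ENNReal.toReal_inv,
      ENNReal.toReal_ofReal hT.le, smul_eq_mul, ← mul_assoc, mul_inv_cancel₀ hT.ne', one_mul]
    refine integral_congr_ae ?_
    have h0 : ∀ᵐ q ∂(νn (φ n)), ¬ (q.1 < 0) := by
      rw [ae_iff]; simpa using hsupp (φ n)
    filter_upwards [h0] with q hq
    rw [hχp q (not_lt.1 hq), one_mul]

theorem aux_mass_le {T : ℝ} (hT : 0 < T) {O A : Set ℝ} {b σ : ℝ → ℝ → ℝ → ℝ} {m0 : Measure ℝ}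
    (hm0 : InitAssumption O m0) {μ : Measure (ℝ × ℝ)} {m : ℝ → Measure (ℝ × ℝ)}
    (hR : MemR T O A b σ m0 μ m) : ∀ᵐ t ∂(volume.restrict (Icc 0 T)), m t univ ≤ 1 := by
  obtain ⟨hμ, hμs, ⟨hmfin, hms, hmm, hmi⟩, hFP⟩ := hR
  have hm0p := hm0.1
  have hM : Measurable fun t => m t univ := hmm _ MeasurableSet.univ
  have hlt : ∫⁻ t in Icc 0 T, m t univ < ⊤ := by
    have := hmi.2
    rw [hasFiniteIntegral_iff_ofReal (ae_of_all _ fun t => ENNReal.toReal_nonneg)] at this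
    simpa [ENNReal.ofReal_toReal (hmfin _).ne] using this
  have hfin : IsFiniteMeasure ((volume.restrict (Icc 0 T)).withDensity fun t => m t univ) :=
    isFiniteMeasure_withDensity hlt.ne
  have hle : (volume.restrict (Icc 0 T)).withDensity (fun t => m t univ)
      ≤ volume.restrict (Icc 0 T) := by
    apply aux_measure_le
    rintro ψ hψ hψ0 ⟨C, hψC⟩
    let φ : ℝ → ℝ := fun t => ∫ s in T..t, ψ s
    have hφd : ∀ t, HasDerivAt φ (ψ t) t := fun t =>
      intervalIntegral.integral_hasDerivAt_right (hψ.intervalIntegrable _ _)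
        (hψ.stronglyMeasurableAtFilter _ _) hψ.continuousAt
    have hφc : Continuous φ := continuous_iff_continuousAt.2 fun t => (hφd t).continuousAt
    have hφ0 : ∀ t ∈ Icc 0 T, φ t ≤ 0 := fun t ht => by
      simp only [φ]
      rw [intervalIntegral.integral_symm]
      have := intervalIntegral.integral_nonneg (μ := volume) ht.2 (fun u _ => hψ0 u)
      linarith
    obtain ⟨C', hC'⟩ := isCompact_Icc.exists_bound_of_continuousOn (s := Icc 0 T) hφc.continuousOn
    have hcb : IsCb12 T O (fun t _ => φ t) (fun t _ => ψ t) (fun _ _ => 0) (fun _ _ => 0) := by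
      refine ⟨?_, ?_, ?_, ?_, ?_, ?_, ?_, ?_⟩
      · exact (hφc.comp continuous_fst).continuousOn
      · exact (hψ.comp continuous_fst).continuousOn
      · exact continuousOn_const
      · exact continuousOn_const
      · intro t _ x _; exact (hφd t).hasDerivWithinAt
      · intro t _ x _; exact hasDerivWithinAt_const _ _ _
      · intro t _ x _; exact hasDerivWithinAt_const _ _ _
      · refine ⟨max C C', fun t ht x _ => ⟨?_, ?_, ?_, ?_⟩⟩
        · exact (hC' t ht).trans (le_max_right _ _)
        · exact (hψC t).trans (le_max_left _ _)
        · simpa using Or.inl ((abs_nonneg _).trans (hψC t))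
        · simpa using Or.inl ((abs_nonneg _).trans (hψC t))
    have h := hFP _ _ _ _ hcb
    have e1 : ∫ p, φ p.1 ∂μ ≤ 0 := by
      refine integral_nonpos_of_ae ?_
      have : ∀ᵐ p ∂μ, p ∈ Icc 0 T ×ˢ closure O := hμs
      filter_upwards [this] with p hp
      exact hφ0 _ hp.1
    have e2 : ∫ x, φ 0 ∂m0 = φ 0 := by simp
    have e3 : ∫ t in Icc 0 T, (∫ p, (ψ t + (b t p.1 p.2 * 0 + σ t p.1 p.2 ^ 2 / 2 * 0)) ∂(m t))
        = ∫ t, ψ t ∂((volume.restrict (Icc 0 T)).withDensity fun t => m t univ) := by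
      rw [integral_withDensity_eq_integral_toReal_smul hM (ae_of_all _ hmfin)]
      simp [Measure.real]
    have e4 : ∫ t in Icc 0 T, ψ t = - φ 0 := by
      simp only [φ]
      rw [intervalIntegral.integral_symm, neg_neg, intervalIntegral.integral_of_le hT.le,
        integral_Icc_eq_integral_Ioc]
    rw [← e3, e4]
    rw [e2] at h
    linarith
  refine ae_le_of_forall_setLIntegral_le_of_sigmaFinite hM fun s hs _ => ?_
  rw [← withDensity_apply _ hs]
  simpa using hle s

/-- `ν` is the measure associated with the flow `m`. -/
structure AuxAssoc (T : ℝ) (S : Set (ℝ × ℝ)) (m : ℝ → Measure (ℝ × ℝ))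
    (ν : Measure (ℝ × ℝ × ℝ)) : Prop where
  fin : IsFiniteMeasure ν
  marg : ν.map Prod.fst ≤ volume.restrict (Icc 0 T)
  supp : ν (Icc 0 T ×ˢ S)ᶜ = 0
  int : ∀ h : ℝ × ℝ × ℝ → ℝ, Measurable h → (∃ C, ∀ t ∈ Icc 0 T, ∀ p ∈ S, |h (t, p)| ≤ C) →
    ∫ t in Icc 0 T, (∫ p, h (t, p) ∂(m t)) = ∫ q, h q ∂ν

theorem aux_assoc_exists {T : ℝ} {S : Set (ℝ × ℝ)} (hS : MeasurableSet S)
    {m : ℝ → Measure (ℝ × ℝ)} (hms : ∀ t, m t Sᶜ = 0)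
    (hmm : ∀ B : Set (ℝ × ℝ), MeasurableSet B → Measurable fun t => m t B)
    (h1 : ∀ᵐ t ∂(volume.restrict (Icc 0 T)), m t univ ≤ 1) :
    ∃ ν, AuxAssoc T S m ν := by
  classical
  let G : Set ℝ := {t | m t univ ≤ 1}
  have hG : MeasurableSet G := measurableSet_le (hmm _ MeasurableSet.univ) measurable_const
  let κ : ProbabilityTheory.Kernel ℝ (ℝ × ℝ) :=
    ⟨fun t => if t ∈ G then m t else 0,
      Measurable.ite hG (Measure.measurable_of_measurable_coe _ hmm) measurable_const⟩
  have hκ : ∀ t, κ t = if t ∈ G then m t else 0 := fun t => rfl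
  have hκ1 : ∀ t, κ t univ ≤ 1 := by
    intro t
    rw [hκ]
    split_ifs with h
    · exact h
    · simp
  have hκS : ∀ t, κ t Sᶜ = 0 := by
    intro t
    rw [hκ]
    split_ifs with h
    · exact hms t
    · simp
  have : ProbabilityTheory.IsFiniteKernel κ := ⟨1, ENNReal.one_lt_top, hκ1⟩
  have hκm : ∀ᵐ t ∂(volume.restrict (Icc 0 T)), m t = κ t := by
    filter_upwards [h1] with t ht
    rw [hκ, if_pos (show t ∈ G from ht)]
  have hsupp : ((volume.restrict (Icc 0 T)).compProd κ) (Icc 0 T ×ˢ S)ᶜ = 0 := by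
    rw [Measure.compProd_apply (measurableSet_Icc.prod hS).compl]
    rw [lintegral_eq_zero_iff (ProbabilityTheory.Kernel.measurable_kernel_prodMk_left (measurableSet_Icc.prod hS).compl)]
    filter_upwards [ae_restrict_mem measurableSet_Icc] with t ht
    refine measure_mono_null ?_ (hκS t)
    intro p hp hpS
    exact hp ⟨ht, hpS⟩
  refine ⟨(volume.restrict (Icc 0 T)).compProd κ, inferInstance, ?_, hsupp, ?_⟩
  · refine Measure.le_iff.2 fun s hs => ?_
    rw [Measure.map_apply measurable_fst hs]
    have : (Prod.fst ⁻¹' s : Set (ℝ × ℝ × ℝ)) = s ×ˢ univ := by ext; simp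
    rw [this, Measure.compProd_apply_prod hs MeasurableSet.univ]
    calc _ ≤ ∫⁻ t in s, 1 ∂(volume.restrict (Icc 0 T)) := lintegral_mono fun t => hκ1 t
      _ = _ := by simp
  · rintro h hh ⟨C, hC⟩
    have hi : Integrable h ((volume.restrict (Icc 0 T)).compProd κ) := by
      refine Integrable.of_bound hh.aestronglyMeasurable C ?_
      have : ∀ᵐ q ∂((volume.restrict (Icc 0 T)).compProd κ), q ∈ Icc 0 T ×ˢ S := hsupp
      filter_upwards [this] with q hq
      exact hC q.1 hq.1 q.2 hq.2
    rw [Measure.integral_compProd hi]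
    refine integral_congr_ae ?_
    filter_upwards [hκm] with t ht
    rw [ht]

theorem aux_assoc_inverse {T : ℝ} {O A : Set ℝ} (hA : MeasurableSet A)
    (ν : Measure (ℝ × ℝ × ℝ)) [IsFiniteMeasure ν]
    (hmarg : ν.map Prod.fst ≤ volume.restrict (Icc 0 T))
    (hsupp : ν (Icc 0 T ×ˢ (closure O ×ˢ A))ᶜ = 0) :
    ∃ m, MemV T O A m ∧ AuxAssoc T (closure O ×ˢ A) m ν := by
  classical
  set S : Set (ℝ × ℝ) := closure O ×ˢ A with hSdef
  have hS : MeasurableSet S := isClosed_closure.measurableSet.prod hA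
  set lam : Measure ℝ := volume.restrict (Icc 0 T) with hlam
  have hmarg' : ν.fst ≤ lam := hmarg
  have hac : ν.fst ≪ lam := Measure.absolutelyContinuous_of_le hmarg'
  let d : ℝ → ENNReal := ν.fst.rnDeriv lam
  have hd : Measurable d := Measure.measurable_rnDeriv _ _
  have hwd : lam.withDensity d = ν.fst := Measure.withDensity_rnDeriv_eq _ _ hac
  have hd1 : ∀ᵐ t ∂lam, d t ≤ 1 := by
    refine ae_le_of_forall_setLIntegral_le_of_sigmaFinite hd fun s hs _ => ?_
    rw [← withDensity_apply _ hs, hwd]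
    simpa using hmarg' s
  let κ := ν.condKernel
  have hdis : ν.fst.compProd κ = ν := ν.disintegrate ν.condKernel
  let G : Set ℝ := {t | κ t Sᶜ = 0 ∧ d t ≤ 1}
  have hG : MeasurableSet G :=
    ((ProbabilityTheory.Kernel.measurable_coe κ hS.compl) (measurableSet_singleton 0)).inter
      (measurableSet_le hd measurable_const)
  let m : ℝ → Measure (ℝ × ℝ) := fun t => if t ∈ G then d t • κ t else 0
  have hmt : ∀ t, m t = if t ∈ G then d t • κ t else 0 := fun t => rfl
  have hgood : ∀ᵐ t ∂ν.fst, κ t Sᶜ = 0 := by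
    have h1 : ν (Prod.snd ⁻¹' Sᶜ) = 0 := by
      refine measure_mono_null ?_ hsupp
      intro q hq hq'
      exact hq hq'.2
    rw [← hdis, Measure.compProd_apply (measurable_snd hS.compl),
      lintegral_eq_zero_iff (ProbabilityTheory.Kernel.measurable_kernel_prodMk_left (measurable_snd hS.compl))] at h1
    filter_upwards [h1] with t ht
    exact ht
  have hgood' : ∀ᵐ t ∂lam, d t ≠ 0 → κ t Sᶜ = 0 := by
    rw [← hwd, ae_withDensity_iff hd] at hgood
    exact hgood
  have hmae : ∀ᵐ t ∂lam, m t = d t • κ t := by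
    filter_upwards [hgood', hd1] with t h1 h2
    rw [hmt]
    by_cases h0 : d t = 0
    · simp [h0]
    · rw [if_pos (show t ∈ G from ⟨h1 h0, h2⟩)]
  have hm1 : ∀ t, m t univ ≤ 1 := by
    intro t
    rw [hmt]
    split_ifs with h
    · simpa using h.2
    · simp
  have hms : ∀ t, m t Sᶜ = 0 := by
    intro t
    rw [hmt]
    split_ifs with h
    · simp [h.1]
    · simp
  have hmm : ∀ B : Set (ℝ × ℝ), MeasurableSet B → Measurable fun t => m t B := by
    intro B hB
    have : (fun t => m t B) = fun t => if t ∈ G then d t * κ t B else 0 := by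
      ext t
      rw [hmt]
      split_ifs <;> simp
    rw [this]
    exact Measurable.ite hG (hd.mul (ProbabilityTheory.Kernel.measurable_coe κ hB)) measurable_const
  refine ⟨m, ⟨fun t => (hm1 t).trans_lt ENNReal.one_lt_top, hms, hmm, ?_⟩, inferInstance, hmarg, hsupp, ?_⟩
  · refine Integrable.of_bound (hmm _ MeasurableSet.univ).ennreal_toReal.aestronglyMeasurable 1
      (ae_of_all _ fun t => ?_)
    rw [Real.norm_of_nonneg ENNReal.toReal_nonneg]
    exact ENNReal.toReal_mono ENNReal.one_ne_top (hm1 t)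
  · rintro h hh ⟨C, hC⟩
    have hi : Integrable h ν := by
      refine Integrable.of_bound hh.aestronglyMeasurable C ?_
      have : ∀ᵐ q ∂ν, q ∈ Icc 0 T ×ˢ S := hsupp
      filter_upwards [this] with q hq
      exact hC q.1 hq.1 q.2 hq.2
    have e1 : ∫ q, h q ∂ν = ∫ t, ∫ p, h (t, p) ∂(κ t) ∂ν.fst := by
      rw [← hdis] at hi
      rw [← Measure.integral_compProd hi, hdis]
    rw [e1, ← hwd, integral_withDensity_eq_integral_toReal_smul hd
      (by filter_upwards [hd1] with t ht using ht.trans_lt ENNReal.one_lt_top)]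
    refine integral_congr_ae ?_
    filter_upwards [hmae] with t ht
    rw [ht, integral_smul_measure]

/-- Truncated Lyapunov function. -/
def auxV (δ x : ℝ) : ℝ := Real.log (1 + x ^ 2) - Real.log (1 + δ * x ^ 2)

/-- First derivative of `auxV`. -/
def auxV1 (δ x : ℝ) : ℝ := 2 * x / (1 + x ^ 2) - 2 * δ * x / (1 + δ * x ^ 2)

/-- Second derivative of `auxV`. -/
def auxV2 (δ x : ℝ) : ℝ :=
  (2 - 2 * x ^ 2) / (1 + x ^ 2) ^ 2 - (2 * δ - 2 * δ ^ 2 * x ^ 2) / (1 + δ * x ^ 2) ^ 2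

theorem auxV_deriv {δ : ℝ} (hδ : 0 < δ) (x : ℝ) : HasDerivAt (auxV δ) (auxV1 δ x) x := by
  have h1 : HasDerivAt (fun y : ℝ => 1 + y ^ 2) (2 * x) x := by
    simpa using (hasDerivAt_pow 2 x).const_add 1
  have h2 : HasDerivAt (fun y : ℝ => 1 + δ * y ^ 2) (2 * δ * x) x :=
    (((hasDerivAt_pow 2 x).const_mul δ).const_add 1).congr_deriv (by norm_num; ring)
  exact (h1.log (by positivity)).sub (h2.log (by positivity))

theorem auxV1_deriv {δ : ℝ} (hδ : 0 < δ) (x : ℝ) : HasDerivAt (auxV1 δ) (auxV2 δ x) x := by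
  have h1 : HasDerivAt (fun y : ℝ => 1 + y ^ 2) (2 * x) x := by
    simpa using (hasDerivAt_pow 2 x).const_add 1
  have h2 : HasDerivAt (fun y : ℝ => 1 + δ * y ^ 2) (2 * δ * x) x :=
    (((hasDerivAt_pow 2 x).const_mul δ).const_add 1).congr_deriv (by norm_num; ring)
  have h3 : HasDerivAt (fun y : ℝ => 2 * y) 2 x := by
    simpa using (hasDerivAt_id x).const_mul 2
  have h4 : HasDerivAt (fun y : ℝ => 2 * δ * y) (2 * δ) x := by
    simpa using (hasDerivAt_id x).const_mul (2 * δ)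
  refine ((h3.div h1 (by positivity)).sub (h4.div h2 (by positivity))).congr_deriv ?_
  unfold auxV2
  congr 2 <;> ring

theorem auxV_cont {δ : ℝ} (hδ : 0 < δ) : Continuous (auxV δ) :=
  continuous_iff_continuousAt.2 fun x => (auxV_deriv hδ x).continuousAt

theorem auxV1_cont {δ : ℝ} (hδ : 0 < δ) : Continuous (auxV1 δ) :=
  continuous_iff_continuousAt.2 fun x => (auxV1_deriv hδ x).continuousAt

theorem auxV2_cont {δ : ℝ} (hδ : 0 < δ) : Continuous (auxV2 δ) := by
  unfold auxV2
  refine Continuous.sub (Continuous.div (by fun_prop) (by fun_prop) fun x => by positivity)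
    (Continuous.div (by fun_prop) (by fun_prop) fun x => by positivity)

theorem auxV_nonneg {δ : ℝ} (hδ : 0 < δ) (hδ1 : δ ≤ 1) (x : ℝ) : 0 ≤ auxV δ x := by
  unfold auxV
  rw [sub_nonneg]
  exact Real.log_le_log (by positivity) (by nlinarith [sq_nonneg x])

theorem auxV_le {δ : ℝ} (hδ : 0 < δ) (hδ1 : δ ≤ 1) (x : ℝ) : auxV δ x ≤ Real.log (1 / δ) := by
  unfold auxV
  rw [sub_le_iff_le_add, ← Real.log_mul (by positivity) (by positivity)]
  refine Real.log_le_log (by positivity) ?_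
  rw [mul_add, ← mul_assoc, one_div, inv_mul_cancel₀ hδ.ne', mul_one, one_mul]
  have := (one_le_inv₀ hδ).2 hδ1
  linarith

theorem auxV_le_log {δ : ℝ} (hδ : 0 < δ) (x : ℝ) : auxV δ x ≤ 2 * Real.log (1 + |x|) := by
  unfold auxV
  have h1 : 0 ≤ Real.log (1 + δ * x ^ 2) := Real.log_nonneg (by nlinarith [sq_nonneg x])
  have h2 : Real.log (1 + x ^ 2) ≤ 2 * Real.log (1 + |x|) := by
    have : 2 * Real.log (1 + |x|) = Real.log ((1 + |x|) ^ 2) := by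
      rw [Real.log_pow]; norm_num
    rw [this]
    refine Real.log_le_log (by positivity) ?_
    nlinarith [sq_abs x, abs_nonneg x]
  linarith

theorem auxV_mono {δ : ℝ} (hδ : 0 < δ) (hδ1 : δ ≤ 1) {x R : ℝ} (h : R ^ 2 ≤ x ^ 2) :
    auxV δ R ≤ auxV δ x := by
  unfold auxV
  rw [sub_le_sub_iff, ← Real.log_mul (by positivity) (by positivity),
    ← Real.log_mul (by positivity) (by positivity)]
  refine Real.log_le_log (by positivity) ?_
  nlinarith [mul_nonneg (sub_nonneg.2 hδ1) (sub_nonneg.2 h)]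

theorem auxV_lower (R : ℝ) : Real.log ((1 + R ^ 2) / 2) ≤ auxV (1 / (1 + R ^ 2)) R := by
  unfold auxV
  rw [Real.log_div (by positivity) (by norm_num)]
  gcongr
  have : 1 / (1 + R ^ 2) * R ^ 2 ≤ 1 := by
    rw [one_div, inv_mul_le_iff₀ (by positivity)]; linarith
  linarith

theorem auxV1_le {δ : ℝ} (hδ : 0 < δ) (hδ1 : δ ≤ 1) (x : ℝ) : |auxV1 δ x| ≤ 2 := by
  unfold auxV1
  have h1 : |2 * x / (1 + x ^ 2)| ≤ 1 := by
    rw [abs_div, abs_of_pos (show 0 < 1 + x ^ 2 by positivity), div_le_one (by positivity), abs_le]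
    constructor <;> nlinarith [sq_nonneg (x - 1), sq_nonneg (x + 1)]
  have h2 : |2 * δ * x / (1 + δ * x ^ 2)| ≤ 1 := by
    rw [abs_div, abs_of_pos (show 0 < 1 + δ * x ^ 2 by positivity), div_le_one (by positivity), abs_le]
    constructor <;> nlinarith [mul_nonneg hδ.le (sq_nonneg (x - 1)), mul_nonneg hδ.le (sq_nonneg (x + 1))]
  refine (abs_sub _ _).trans ?_
  linarith

theorem auxV2_le {δ : ℝ} (hδ : 0 < δ) (hδ1 : δ ≤ 1) (x : ℝ) : |auxV2 δ x| ≤ 4 := by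
  unfold auxV2
  have h1 : |(2 - 2 * x ^ 2) / (1 + x ^ 2) ^ 2| ≤ 2 := by
    rw [abs_div, abs_of_pos (show 0 < (1 + x ^ 2) ^ 2 by positivity), div_le_iff₀ (by positivity), abs_le]
    constructor <;> nlinarith [sq_nonneg x, sq_nonneg (x ^ 2)]
  have h2 : |(2 * δ - 2 * δ ^ 2 * x ^ 2) / (1 + δ * x ^ 2) ^ 2| ≤ 2 := by
    have e : 2 * δ - 2 * δ ^ 2 * x ^ 2 = δ * (2 - 2 * (δ * x ^ 2)) := by ring
    have hy : 0 ≤ δ * x ^ 2 := by positivity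
    rw [e, abs_div, abs_of_pos (show 0 < (1 + δ * x ^ 2) ^ 2 by positivity),
      div_le_iff₀ (by positivity), abs_mul, abs_of_pos hδ]
    generalize δ * x ^ 2 = y at hy
    have h3 : |2 - 2 * y| ≤ 2 * (1 + y) ^ 2 := by
      rw [abs_le]; constructor <;> nlinarith
    nlinarith [abs_nonneg (2 - 2 * y)]
  refine (abs_sub _ _).trans ?_
  linarith

theorem aux_FP {T : ℝ} {O A : Set ℝ} {b σ : ℝ → ℝ → ℝ → ℝ} (hbσ : CoefAssumption O A b σ)
    {m0 : Measure ℝ} {μ : Measure (ℝ × ℝ)} {m : ℝ → Measure (ℝ × ℝ)}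
    (hR : MemR T O A b σ m0 μ m) {ν : Measure (ℝ × ℝ × ℝ)}
    (hν : AuxAssoc T (closure O ×ˢ A) m ν) {u ut ux uxx : ℝ → ℝ → ℝ}
    (hu : IsCb12 T O u ut ux uxx) (hut : Continuous fun p : ℝ × ℝ => ut p.1 p.2)
    (hux : Continuous fun p : ℝ × ℝ => ux p.1 p.2)
    (huxx : Continuous fun p : ℝ × ℝ => uxx p.1 p.2) :
    ∫ p, u p.1 p.2 ∂μ = (∫ x, u 0 x ∂m0) + ∫ q, (ut q.1 q.2.1
      + (b q.1 q.2.1 q.2.2 * ux q.1 q.2.1 + σ q.1 q.2.1 q.2.2 ^ 2 / 2 * uxx q.1 q.2.1)) ∂ν := by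
  rw [hR.2.2.2 u ut ux uxx hu]
  congr 1
  obtain ⟨hbm, hσm, ⟨B, hB⟩, -⟩ := hbσ
  obtain ⟨C, hC⟩ := hu.bdd
  have hpm : Measurable fun q : ℝ × ℝ × ℝ => (q.1, q.2.1) := by fun_prop
  refine hν.int (fun q => ut q.1 q.2.1
      + (b q.1 q.2.1 q.2.2 * ux q.1 q.2.1 + σ q.1 q.2.1 q.2.2 ^ 2 / 2 * uxx q.1 q.2.1)) ?_ ?_
  · exact (hut.measurable.comp hpm).add ((hbm.mul (hux.measurable.comp hpm)).add
      (((hσm.pow_const 2).div_const 2).mul (huxx.measurable.comp hpm)))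
  · refine ⟨C + (B * C + B ^ 2 / 2 * C), fun t ht p hp => ?_⟩
    obtain ⟨-, h2, h3, h4⟩ := hC t ht p.1 hp.1
    obtain ⟨hb1, hb2⟩ := hB t p.1 p.2
    have hB0 : 0 ≤ B := (abs_nonneg _).trans hb1
    have hC0 : 0 ≤ C := (abs_nonneg _).trans h2
    refine (abs_add_le _ _).trans (add_le_add h2 ((abs_add_le _ _).trans (add_le_add ?_ ?_)))
    · rw [abs_mul]; gcongr
    · rw [abs_mul, abs_div, abs_pow, abs_two]; gcongr

theorem aux_assoc_mass {T : ℝ} {S : Set (ℝ × ℝ)} {m : ℝ → Measure (ℝ × ℝ)}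
    {ν : Measure (ℝ × ℝ × ℝ)} (hν : AuxAssoc T S m ν) : ν univ ≤ ENNReal.ofReal T := by
  have h := hν.marg univ
  rw [Measure.map_apply measurable_fst MeasurableSet.univ] at h
  simpa using h

/-- Bound on the generator part. -/
theorem aux_gen_bound {B V1 V2 β s : ℝ} (hβ : |β| ≤ B) (hs : |s| ≤ B) (h1 : |V1| ≤ 2) (h2 : |V2| ≤ 4) :
    |β * V1 + s ^ 2 / 2 * V2| ≤ 2 * B + 2 * B ^ 2 := by
  have hB0 : 0 ≤ B := (abs_nonneg _).trans hβ
  have a1 : |β * V1| ≤ B * 2 := by rw [abs_mul]; gcongr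
  have a2 : |s ^ 2 / 2 * V2| ≤ B ^ 2 / 2 * 4 := by rw [abs_mul, abs_div, abs_pow, abs_two]; gcongr
  refine (abs_add_le _ _).trans ?_
  linarith

theorem aux_tight {T : ℝ} (hT : 0 < T) {O A : Set ℝ} {b σ : ℝ → ℝ → ℝ → ℝ} (hbσ : CoefAssumption O A b σ)
    {B : ℝ} (hB : ∀ t x a, |b t x a| ≤ B ∧ |σ t x a| ≤ B)
    {m0 : Measure ℝ} (hm0 : InitAssumption O m0) {μ : Measure (ℝ × ℝ)} {m : ℝ → Measure (ℝ × ℝ)}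
    (hR : MemR T O A b σ m0 μ m) {ν : Measure (ℝ × ℝ × ℝ)}
    (hν : AuxAssoc T (closure O ×ˢ A) m ν) (R : ℝ) (hR0 : 0 ≤ R) :
    Real.log ((1 + R ^ 2) / 2) * μ.real {p | R ≤ |p.2|}
      ≤ 2 * (∫ x, Real.log (1 + |x|) ∂m0) + T * (2 * B + 2 * B ^ 2) ∧
    Real.log ((1 + R ^ 2) / 2) * ν.real {q | R ≤ |q.2.1|}
      ≤ T * (2 * (∫ x, Real.log (1 + |x|) ∂m0) + T * (2 * B + 2 * B ^ 2)) := by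
  set δ : ℝ := 1 / (1 + R ^ 2) with hδdef
  have hδ : 0 < δ := by positivity
  have hδ1 : δ ≤ 1 := by
    rw [hδdef, div_le_one (by positivity)]; nlinarith [sq_nonneg R]
  set L : ℝ := ∫ x, Real.log (1 + |x|) ∂m0 with hL
  set D : ℝ := 2 * B + 2 * B ^ 2 with hD
  set M : ℝ := Real.log (1 / δ) with hM
  have hM0 : 0 ≤ M := (auxV_nonneg hδ hδ1 0).trans (auxV_le hδ hδ1 0)
  have hVabs : ∀ x, |auxV δ x| ≤ M := fun x => by
    rw [abs_of_nonneg (auxV_nonneg hδ hδ1 x)]; exact auxV_le hδ hδ1 x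
  have hVc := auxV_cont hδ
  have hV1c := auxV1_cont hδ
  have hV2c := auxV2_cont hδ
  have hμp := hR.1
  have hνf := hν.fin
  have hm0p := hm0.1
  have hB0 : 0 ≤ B := (abs_nonneg _).trans (hB 0 0 0).1
  have hD0 : 0 ≤ D := by positivity
  have hνmass : ν.real univ ≤ T := by
    have := ENNReal.toReal_mono ENNReal.ofReal_ne_top (aux_assoc_mass hν)
    rwa [ENNReal.toReal_ofReal hT.le] at this
  have hVm0 : ∫ x, auxV δ x ∂m0 ≤ 2 * L := by
    rw [hL, ← integral_const_mul]
    refine integral_mono (Integrable.of_bound hVc.aestronglyMeasurable M (ae_of_all _ hVabs))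
      (hm0.2.2.const_mul 2) fun x => auxV_le_log hδ x
  have hbm := hbσ.1
  have hσm := hbσ.2.1
  have hsupp : ∀ᵐ q ∂ν, q ∈ Icc 0 T ×ˢ (closure O ×ˢ A) := hν.supp
  have hμsupp : ∀ᵐ p ∂μ, p ∈ Icc 0 T ×ˢ closure O := hR.2.1
  constructor
  · have hcb : IsCb12 T O (fun _ x => auxV δ x) (fun _ _ => 0) (fun _ x => auxV1 δ x)
        (fun _ x => auxV2 δ x) := by
      refine ⟨?_, continuousOn_const, ?_, ?_, ?_, ?_, ?_, ?_⟩
      · exact (hVc.comp continuous_snd).continuousOn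
      · exact (hV1c.comp continuous_snd).continuousOn
      · exact (hV2c.comp continuous_snd).continuousOn
      · intro t _ x _; exact hasDerivWithinAt_const _ _ _
      · intro t _ x _; exact (auxV_deriv hδ x).hasDerivWithinAt
      · intro t _ x _; exact (auxV1_deriv hδ x).hasDerivWithinAt
      · refine ⟨M + 4, fun t _ x _ => ⟨?_, ?_, ?_, ?_⟩⟩
        · linarith [hVabs x]
        · simp; linarith
        · linarith [auxV1_le hδ hδ1 x]
        · linarith [auxV2_le hδ hδ1 x]
    have h := aux_FP hbσ hR hν hcb continuous_const (hV1c.comp continuous_snd) (hV2c.comp continuous_snd)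
    have e1 : ∫ q, ((0:ℝ) + (b q.1 q.2.1 q.2.2 * auxV1 δ q.2.1
        + σ q.1 q.2.1 q.2.2 ^ 2 / 2 * auxV2 δ q.2.1)) ∂ν ≤ T * D := by
      refine (Real.le_norm_self _).trans ((norm_integral_le_of_norm_le_const (C := D)
        (ae_of_all _ fun q => ?_)).trans ?_)
      · rw [zero_add]
        exact aux_gen_bound (hB _ _ _).1 (hB _ _ _).2 (auxV1_le hδ hδ1 _) (auxV2_le hδ hδ1 _)
      · rw [mul_comm]; gcongr
    have e2 : Real.log ((1 + R ^ 2) / 2) * μ.real {p | R ≤ |p.2|} ≤ ∫ p, auxV δ p.2 ∂μ := by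
      have hi : Integrable (fun p : ℝ × ℝ => auxV δ p.2) μ :=
        Integrable.of_bound (hVc.comp continuous_snd).aestronglyMeasurable M (ae_of_all _ fun p => hVabs _)
      have := mul_meas_ge_le_integral_of_nonneg (ae_of_all _ fun p : ℝ × ℝ => auxV_nonneg hδ hδ1 p.2) hi (auxV δ R)
      refine le_trans ?_ this
      refine mul_le_mul (auxV_lower R) ?_ measureReal_nonneg (auxV_nonneg hδ hδ1 R)
      refine measureReal_mono fun p hp => ?_
      exact auxV_mono hδ hδ1 (by rw [← sq_abs p.2]; exact pow_le_pow_left₀ hR0 hp 2)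
    linarith
  · have hcb : IsCb12 T O (fun t x => (T - t) * auxV δ x) (fun _ x => - auxV δ x)
        (fun t x => (T - t) * auxV1 δ x) (fun t x => (T - t) * auxV2 δ x) := by
      refine ⟨?_, ?_, ?_, ?_, ?_, ?_, ?_, ?_⟩
      · exact Continuous.continuousOn (by fun_prop)
      · exact Continuous.continuousOn (by fun_prop)
      · exact Continuous.continuousOn (by fun_prop)
      · exact Continuous.continuousOn (by fun_prop)
      · intro t _ x _
        simpa using (((hasDerivAt_id t).const_sub T).mul_const (auxV δ x)).hasDerivWithinAt
      · intro t _ x _; exact ((auxV_deriv hδ x).const_mul _).hasDerivWithinAt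
      · intro t _ x _; exact ((auxV1_deriv hδ x).const_mul _).hasDerivWithinAt
      · refine ⟨(1 + T) * (M + 4), fun t ht x _ => ?_⟩
        have a0 : 0 ≤ T - t := by linarith [ht.2]
        have a1 : T - t ≤ 1 + T := by linarith [ht.1]
        have key : ∀ y, |y| ≤ M + 4 → |(T - t) * y| ≤ (1 + T) * (M + 4) := fun y hy => by
          rw [abs_mul, abs_of_nonneg a0]
          exact mul_le_mul a1 hy (abs_nonneg _) (by linarith)
        refine ⟨key _ ?_, ?_, key _ ?_, key _ ?_⟩
        · linarith [hVabs x]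
        · rw [abs_neg]; nlinarith [hVabs x]
        · linarith [auxV1_le hδ hδ1 x]
        · linarith [auxV2_le hδ hδ1 x]
    have h := aux_FP hbσ hR hν hcb (by fun_prop) (by fun_prop) (by fun_prop)
    have hi : Integrable (fun q : ℝ × ℝ × ℝ => auxV δ q.2.1) ν :=
        Integrable.of_bound (by fun_prop) M (ae_of_all _ fun p => hVabs _)
    have hgm : Measurable fun q : ℝ × ℝ × ℝ => b q.1 q.2.1 q.2.2 * ((T - q.1) * auxV1 δ q.2.1)
        + σ q.1 q.2.1 q.2.2 ^ 2 / 2 * ((T - q.1) * auxV2 δ q.2.1) := by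
      have c1 : Continuous fun q : ℝ × ℝ × ℝ => (T - q.1) * auxV1 δ q.2.1 := by fun_prop
      have c2 : Continuous fun q : ℝ × ℝ × ℝ => (T - q.1) * auxV2 δ q.2.1 := by fun_prop
      exact (hbm.mul c1.measurable).add (((hσm.pow_const 2).div_const 2).mul c2.measurable)
    have hgb : ∀ᵐ q ∂ν, ‖b q.1 q.2.1 q.2.2 * ((T - q.1) * auxV1 δ q.2.1)
        + σ q.1 q.2.1 q.2.2 ^ 2 / 2 * ((T - q.1) * auxV2 δ q.2.1)‖ ≤ T * D := by
      filter_upwards [hsupp] with q hq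
      have a0 : 0 ≤ T - q.1 := by linarith [hq.1.2]
      have a1 : T - q.1 ≤ T := by linarith [hq.1.1]
      have := aux_gen_bound (hB q.1 q.2.1 q.2.2).1 (hB q.1 q.2.1 q.2.2).2
        (auxV1_le hδ hδ1 q.2.1) (auxV2_le hδ hδ1 q.2.1)
      have e : b q.1 q.2.1 q.2.2 * ((T - q.1) * auxV1 δ q.2.1)
          + σ q.1 q.2.1 q.2.2 ^ 2 / 2 * ((T - q.1) * auxV2 δ q.2.1)
          = (T - q.1) * (b q.1 q.2.1 q.2.2 * auxV1 δ q.2.1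
          + σ q.1 q.2.1 q.2.2 ^ 2 / 2 * auxV2 δ q.2.1) := by ring
      rw [e, Real.norm_eq_abs, abs_mul, abs_of_nonneg a0]
      exact mul_le_mul a1 this (abs_nonneg _) hT.le
    have hgi := Integrable.of_bound (μ := ν) hgm.aestronglyMeasurable _ hgb
    have e1 : ∫ q, (b q.1 q.2.1 q.2.2 * ((T - q.1) * auxV1 δ q.2.1)
        + σ q.1 q.2.1 q.2.2 ^ 2 / 2 * ((T - q.1) * auxV2 δ q.2.1)) ∂ν ≤ T * (T * D) := by
      refine (Real.le_norm_self _).trans ((norm_integral_le_of_norm_le_const hgb).trans ?_)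
      rw [mul_comm T (T * D)]; gcongr
    have e2 : Real.log ((1 + R ^ 2) / 2) * ν.real {q | R ≤ |q.2.1|} ≤ ∫ q, auxV δ q.2.1 ∂ν := by
      have := mul_meas_ge_le_integral_of_nonneg
        (ae_of_all _ fun q : ℝ × ℝ × ℝ => auxV_nonneg hδ hδ1 q.2.1) hi (auxV δ R)
      refine le_trans ?_ this
      refine mul_le_mul (auxV_lower R) ?_ measureReal_nonneg (auxV_nonneg hδ hδ1 R)
      refine measureReal_mono fun p hp => ?_
      exact auxV_mono hδ hδ1 (by rw [← sq_abs p.2.1]; exact pow_le_pow_left₀ hR0 hp 2)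
    have e3 : 0 ≤ ∫ p, (T - p.1) * auxV δ p.2 ∂μ := by
      refine integral_nonneg_of_ae ?_
      filter_upwards [hμsupp] with p hp
      exact mul_nonneg (by linarith [hp.1.2]) (auxV_nonneg hδ hδ1 _)
    have e4 : ∫ x, (T - 0) * auxV δ x ∂m0 ≤ T * (2 * L) := by
      rw [integral_const_mul, sub_zero]; gcongr
    have e5 := integral_add hi.neg hgi
    have e6 : ∫ q, (-fun q : ℝ × ℝ × ℝ => auxV δ q.2.1) q ∂ν = - ∫ q, auxV δ q.2.1 ∂ν := integral_neg _
    simp only [Pi.neg_apply] at e5 e6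
    rw [e5, e6] at h
    linarith

theorem aux_ext {Z : Set (ℝ × ℝ)} (hZ : IsClosed Z) {f : ℝ × ℝ → ℝ} (hf : ContinuousOn f Z) {C : ℝ}
    (hC0 : 0 ≤ C) (hC : ∀ p ∈ Z, |f p| ≤ C) :
    ∃ g : ℝ × ℝ → ℝ, Continuous g ∧ (∀ p, |g p| ≤ C) ∧ ∀ p ∈ Z, g p = f p := by
  obtain ⟨g1, hg1⟩ := ContinuousMap.exists_extension hZ.isClosedEmbedding_subtypeVal
    (⟨_, hf.domRestrict⟩ : C(Z, ℝ))
  have hc := g1.continuous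
  refine ⟨fun p => max (-C) (min C (g1 p)), by fun_prop, fun p => ?_, fun p hp => ?_⟩
  · rw [abs_le]
    exact ⟨le_max_left _ _, max_le (by linarith) (min_le_left _ _)⟩
  · have e : g1 p = f p := congrArg (fun k : C(Z, ℝ) => k ⟨p, hp⟩) hg1
    have := abs_le.1 (hC p hp)
    simp only [e]
    rw [min_eq_right this.2, max_eq_right this.1]

theorem aux_supp {E : Type*} [MetricSpace E] [MeasurableSpace E] [BorelSpace E]
    [SecondCountableTopology E]
    (P : ℕ → Measure E) (Q : Measure E) [IsFiniteMeasure Q]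
    (hw : ∀ h : E → ℝ, Continuous h → (∃ C, ∀ q, |h q| ≤ C) →
      Tendsto (fun n => ∫ q, h q ∂(P n)) atTop (𝓝 (∫ q, h q ∂Q)))
    {Z : Set E} (hZ : IsClosed Z) (hP : ∀ n, P n Zᶜ = 0) : Q Zᶜ = 0 := by
  rcases Z.eq_empty_or_nonempty with rfl | hne
  · have h1 := hw (fun _ => 1) continuous_const ⟨1, fun _ => by simp⟩
    have h2 : ∀ n, P n = 0 := fun n => by
      have := hP n
      rwa [compl_empty, Measure.measure_univ_eq_zero] at this
    simp only [h2, integral_zero_measure] at h1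
    have h3 := tendsto_nhds_unique h1 tendsto_const_nhds
    simp only [integral_const, smul_eq_mul, mul_one] at h3
    rw [compl_empty]
    rwa [measureReal_eq_zero_iff] at h3
  · let h : E → ℝ := fun q => min 1 (Metric.infDist q Z)
    have hc : Continuous h := continuous_const.min (Metric.continuous_infDist_pt Z)
    have h0 : ∀ q, 0 ≤ h q := fun q => le_min zero_le_one Metric.infDist_nonneg
    have hb : ∀ q, |h q| ≤ 1 := fun q => by rw [abs_of_nonneg (h0 q)]; exact min_le_left _ _
    have h1 := hw h hc ⟨1, hb⟩
    have h2 : ∀ n, ∫ q, h q ∂(P n) = 0 := fun n => by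
      refine integral_eq_zero_of_ae ?_
      have : ∀ᵐ q ∂(P n), q ∈ Z := hP n
      filter_upwards [this] with q hq
      simp [h, Metric.infDist_zero_of_mem hq]
    simp only [h2] at h1
    have h3 := tendsto_nhds_unique h1 tendsto_const_nhds
    rw [integral_eq_zero_iff_of_nonneg h0
      (Integrable.of_bound hc.aestronglyMeasurable 1 (ae_of_all _ hb))] at h3
    have : ∀ᵐ q ∂Q, q ∈ Z := by
      filter_upwards [h3] with q hq
      rw [hZ.mem_iff_infDist_zero hne]
      have hq' : min 1 (Metric.infDist q Z) = 0 := hq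
      rcases min_choice 1 (Metric.infDist q Z) with h | h <;> rw [h] at hq'
      · norm_num at hq'
      · exact hq'
    exact this

theorem aux_exists_R {C : ℝ} {ε : ℝ} (hε : 0 < ε) :
    ∃ R : ℝ, 0 ≤ R ∧ ∀ x : ℝ, Real.log ((1 + R ^ 2) / 2) * x ≤ C → 0 ≤ x → x ≤ ε := by
  have h1 : Tendsto (fun R : ℝ => Real.log ((1 + R ^ 2) / 2)) atTop atTop := by
    refine Real.tendsto_log_atTop.comp ?_
    refine Tendsto.atTop_div_const two_pos ?_
    exact tendsto_atTop_add_const_left _ _ (tendsto_pow_atTop two_ne_zero)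
  obtain ⟨R, hR1, hR0⟩ := ((h1.eventually_ge_atTop ((|C| + 1) / ε)).and (eventually_ge_atTop 0)).exists
  refine ⟨R, hR0, fun x hx hx0 => ?_⟩
  by_contra hcon
  push Not at hcon
  have h2 : (|C| + 1) / ε * ε ≤ Real.log ((1 + R ^ 2) / 2) * x :=
    mul_le_mul hR1 hcon.le hε.le (le_trans (by positivity) hR1)
  rw [div_mul_cancel₀ _ hε.ne'] at h2
  linarith [le_abs_self C]

theorem aux_le_of_real {E : Type*} [MeasurableSpace E] (P : Measure E) [IsFiniteMeasure P] {s : Set E}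
    {ε : ENNReal} (h : P.real s ≤ (min ε 1).toReal) : P s ≤ ε := by
  have h1 : min ε 1 ≠ ⊤ := ne_top_of_le_ne_top ENNReal.one_ne_top (min_le_right _ _)
  exact ((ENNReal.toReal_le_toReal (measure_ne_top P s) h1).1 h).trans (min_le_left _ _)

/-- Compactness of the constraint set `R`: every sequence
`(μⁿ, mⁿ) ⊆ R` admits a subsequence `(μ^{n_k}, m^{n_k})` and an element `(μ, m) ∈ R`
such that `μ^{n_k}` converges weakly to `μ` and `m^{n_k} → m` in `V`. -/
theorem memR_compact
    (T : ℝ) (hT : 0 < T) (O A : Set ℝ) (hO : IsOpen O) (hA : IsCompact A)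
    (b σ : ℝ → ℝ → ℝ → ℝ) (hbσ : CoefAssumption O A b σ)
    (m0 : Measure ℝ) (hm0 : InitAssumption O m0)
    (μn : ℕ → Measure (ℝ × ℝ)) (mn : ℕ → ℝ → Measure (ℝ × ℝ))
    (hRn : ∀ n, MemR T O A b σ m0 (μn n) (mn n)) :
    ∃ φ : ℕ → ℕ, StrictMono φ ∧
      ∃ (μ : Measure (ℝ × ℝ)) (m : ℝ → Measure (ℝ × ℝ)),
        MemR T O A b σ m0 μ m ∧
        WeakConv (fun k => μn (φ k)) μ ∧
        ConvV T (fun k => mn (φ k)) m := by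
  have hSc : IsClosed (closure O ×ˢ A) := isClosed_closure.prod hA.isClosed
  have hass : ∀ n, ∃ ν, AuxAssoc T (closure O ×ˢ A) (mn n) ν := fun n =>
    aux_assoc_exists hSc.measurableSet (hRn n).2.2.1.2.1 (hRn n).2.2.1.2.2.1
      (aux_mass_le hT hm0 (hRn n))
  choose νn hνn using hass
  obtain ⟨B, hB⟩ := hbσ.2.2.1
  have hμp : ∀ n, IsProbabilityMeasure (μn n) := fun n => (hRn n).1
  have hνf : ∀ n, IsFiniteMeasure (νn n) := fun n => (hνn n).fin
  -- uniform tails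
  have htailμ : ∀ ε : ℝ, 0 < ε → ∃ R : ℝ, ∀ n, (μn n).real {p | R ≤ |p.2|} ≤ ε := by
    intro ε hε
    obtain ⟨R, hR0, hR⟩ := aux_exists_R (C := 2 * (∫ x, Real.log (1 + |x|) ∂m0)
      + T * (2 * B + 2 * B ^ 2)) hε
    exact ⟨R, fun n => hR _ (aux_tight hT hbσ hB hm0 (hRn n) (hνn n) R hR0).1 measureReal_nonneg⟩
  have htailν : ∀ ε : ℝ, 0 < ε → ∃ R : ℝ, ∀ n, (νn n).real {q | R ≤ |q.2.1|} ≤ ε := by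
    intro ε hε
    obtain ⟨R, hR0, hR⟩ := aux_exists_R (C := T * (2 * (∫ x, Real.log (1 + |x|) ∂m0)
      + T * (2 * B + 2 * B ^ 2))) hε
    exact ⟨R, fun n => hR _ (aux_tight hT hbσ hB hm0 (hRn n) (hνn n) R hR0).2 measureReal_nonneg⟩
  have hmin : ∀ ε : ENNReal, 0 < ε → 0 < (min ε 1).toReal := fun ε hε =>
    ENNReal.toReal_pos (ne_of_gt (lt_min hε one_pos))
      (ne_top_of_le_ne_top ENNReal.one_ne_top (min_le_right _ _))
  have htightμ : ∀ ε : ENNReal, 0 < ε → ∃ K : Set (ℝ × ℝ), IsCompact K ∧ ∀ n, μn n Kᶜ ≤ ε := by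
    intro ε hε
    obtain ⟨R, hR⟩ := htailμ _ (hmin ε hε)
    refine ⟨Icc 0 T ×ˢ Icc (-R) R, isCompact_Icc.prod isCompact_Icc, fun n => ?_⟩
    refine le_trans ?_ (aux_le_of_real (μn n) (hR n))
    refine measure_mono_ae ?_
    have : ∀ᵐ p ∂(μn n), p ∈ Icc 0 T ×ˢ closure O := (hRn n).2.1
    filter_upwards [this] with p hp hpK
    by_contra hcon
    have hcon' : ¬ (R ≤ |p.2|) := hcon
    exact hpK ⟨hp.1, abs_le.1 (not_le.1 hcon').le⟩
  have htightν : ∀ ε : ENNReal, 0 < ε → ∃ K : Set (ℝ × ℝ × ℝ), IsCompact K ∧ ∀ n, νn n Kᶜ ≤ ε := by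
    intro ε hε
    obtain ⟨R, hR⟩ := htailν _ (hmin ε hε)
    refine ⟨Icc 0 T ×ˢ (Icc (-R) R ×ˢ A), isCompact_Icc.prod (isCompact_Icc.prod hA), fun n => ?_⟩
    refine le_trans ?_ (aux_le_of_real (νn n) (hR n))
    refine measure_mono_ae ?_
    have : ∀ᵐ q ∂(νn n), q ∈ Icc 0 T ×ˢ (closure O ×ˢ A) := (hνn n).supp
    filter_upwards [this] with q hq hqK
    by_contra hcon
    have hcon' : ¬ (R ≤ |q.2.1|) := hcon
    exact hqK ⟨hq.1, abs_le.1 (not_le.1 hcon').le, hq.2.2⟩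
  -- extraction
  obtain ⟨φ1, hφ1, μ, hμ, hμlim1⟩ := aux_seq_compact_prob μn htightμ
  obtain ⟨φ2, hφ2, ν, hν, hνlim⟩ := aux_seq_compact_fin (fun n => νn (φ1 n)) hT
    (fun n => aux_assoc_mass (hνn (φ1 n)))
    (fun n => by
      refine measure_mono_null ?_ (hνn (φ1 n)).supp
      intro q hq hq'
      have hq0 : q.1 < 0 := hq
      exact absurd hq'.1.1 (not_le.2 hq0))
    (fun ε hε => by
      obtain ⟨K, hK, h⟩ := htightν ε hε
      exact ⟨K, hK, fun n => h _⟩)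
  let φ : ℕ → ℕ := fun n => φ1 (φ2 n)
  have hφ : StrictMono φ := hφ1.comp hφ2
  have hμlim : ∀ h : ℝ × ℝ → ℝ, Continuous h → (∃ C, ∀ q, |h q| ≤ C) →
      Tendsto (fun n => ∫ q, h q ∂(μn (φ n))) atTop (𝓝 (∫ q, h q ∂μ)) :=
    fun h hh hb => (hμlim1 h hh hb).comp hφ2.tendsto_atTop
  have hνlim' : ∀ h : ℝ × ℝ × ℝ → ℝ, Continuous h → (∃ C, ∀ q, |h q| ≤ C) →
      Tendsto (fun n => ∫ q, h q ∂(νn (φ n))) atTop (𝓝 (∫ q, h q ∂ν)) := hνlim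
  have hZ : IsClosed (Icc 0 T ×ˢ closure O) := isClosed_Icc.prod isClosed_closure
  have hμsupp : μ (Icc 0 T ×ˢ closure O)ᶜ = 0 :=
    aux_supp _ μ hμlim hZ fun n => (hRn (φ n)).2.1
  have hνsupp : ν (Icc 0 T ×ˢ (closure O ×ˢ A))ᶜ = 0 :=
    aux_supp _ ν hνlim' (isClosed_Icc.prod hSc) fun n => (hνn (φ n)).supp
  have hνmarg : ν.map Prod.fst ≤ volume.restrict (Icc 0 T) := by
    apply aux_measure_le
    rintro ψ hψ hψ0 ⟨C, hψC⟩
    rw [integral_map measurable_fst.aemeasurable hψ.aestronglyMeasurable]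
    refine le_of_tendsto' (hνlim' (fun q => ψ q.1) (hψ.comp continuous_fst) ⟨C, fun q => hψC _⟩) fun n => ?_
    rw [← integral_map (φ := Prod.fst) (f := ψ) measurable_fst.aemeasurable hψ.aestronglyMeasurable]
    exact integral_mono_measure (hνn (φ n)).marg (ae_of_all _ hψ0)
      (Integrable.of_bound hψ.aestronglyMeasurable C (ae_of_all _ hψC))
  obtain ⟨m, hmV, hm⟩ := aux_assoc_inverse hA.measurableSet ν hνmarg hνsupp
  refine ⟨φ, hφ, μ, m, ⟨hμ, hμsupp, hmV, ?_⟩, hμlim, ?_⟩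
  · intro u ut ux uxx hu
    obtain ⟨C, hC⟩ := hu.bdd
    have hC' : ∀ t ∈ Icc 0 T, ∀ x ∈ closure O,
        |u t x| ≤ |C| ∧ |ut t x| ≤ |C| ∧ |ux t x| ≤ |C| ∧ |uxx t x| ≤ |C| := fun t ht x hx =>
      ⟨(hC t ht x hx).1.trans (le_abs_self C), (hC t ht x hx).2.1.trans (le_abs_self C),
        (hC t ht x hx).2.2.1.trans (le_abs_self C), (hC t ht x hx).2.2.2.trans (le_abs_self C)⟩
    obtain ⟨U, hUc, hUb, hU⟩ := aux_ext hZ hu.cont (abs_nonneg C) fun p hp => (hC' p.1 hp.1 p.2 hp.2).1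
    obtain ⟨Ut, hUtc, hUtb, hUt⟩ := aux_ext hZ hu.cont_t (abs_nonneg C)
      fun p hp => (hC' p.1 hp.1 p.2 hp.2).2.1
    obtain ⟨Ux, hUxc, hUxb, hUx⟩ := aux_ext hZ hu.cont_x (abs_nonneg C)
      fun p hp => (hC' p.1 hp.1 p.2 hp.2).2.2.1
    obtain ⟨Uxx, hUxxc, hUxxb, hUxx⟩ := aux_ext hZ hu.cont_xx (abs_nonneg C)
      fun p hp => (hC' p.1 hp.1 p.2 hp.2).2.2.2
    have hcb : IsCb12 T O (fun t x => U (t, x)) (fun t x => Ut (t, x)) (fun t x => Ux (t, x))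
        (fun t x => Uxx (t, x)) := by
      refine ⟨hUc.continuousOn, hUtc.continuousOn, hUxc.continuousOn, hUxxc.continuousOn, ?_, ?_, ?_, ?_⟩
      · intro t ht x hx
        simp only [hUt (t, x) ⟨ht, hx⟩]
        exact (hu.deriv_t t ht x hx).congr (fun s hs => hU (s, x) ⟨hs, hx⟩) (hU (t, x) ⟨ht, hx⟩)
      · intro t ht x hx
        simp only [hUx (t, x) ⟨ht, hx⟩]
        exact (hu.deriv_x t ht x hx).congr (fun y hy => hU (t, y) ⟨ht, hy⟩) (hU (t, x) ⟨ht, hx⟩)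
      · intro t ht x hx
        simp only [hUxx (t, x) ⟨ht, hx⟩]
        exact (hu.deriv_xx t ht x hx).congr (fun y hy => hUx (t, y) ⟨ht, hy⟩) (hUx (t, x) ⟨ht, hx⟩)
      · exact ⟨|C|, fun t _ x _ => ⟨hUb _, hUtb _, hUxb _, hUxxb _⟩⟩
    let F : ℝ × ℝ × ℝ → ℝ := fun q => Ut (q.1, q.2.1)
      + (b q.1 q.2.1 q.2.2 * Ux (q.1, q.2.1) + σ q.1 q.2.1 q.2.2 ^ 2 / 2 * Uxx (q.1, q.2.1))
    have hB0 : 0 ≤ B := (abs_nonneg _).trans (hB 0 0 0).1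
    have hFm : Measurable F := by
      have hpm : Measurable fun q : ℝ × ℝ × ℝ => (q.1, q.2.1) := by fun_prop
      exact (hUtc.measurable.comp hpm).add ((hbσ.1.mul (hUxc.measurable.comp hpm)).add
        (((hbσ.2.1.pow_const 2).div_const 2).mul (hUxxc.measurable.comp hpm)))
    have hFb : ∀ q, |F q| ≤ |C| + (B * |C| + B ^ 2 / 2 * |C|) := by
      intro q
      obtain ⟨hb1, hb2⟩ := hB q.1 q.2.1 q.2.2
      refine (abs_add_le _ _).trans (add_le_add (hUtb _) ((abs_add_le _ _).trans (add_le_add ?_ ?_)))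
      · rw [abs_mul]; exact mul_le_mul hb1 (hUxb _) (abs_nonneg _) hB0
      · rw [abs_mul, abs_div, abs_pow, abs_two]
        refine mul_le_mul ?_ (hUxxb _) (abs_nonneg _) (by positivity)
        gcongr
    have hFc : ∀ t, ContinuousOn (fun p => F (t, p)) (closure O ×ˢ A) := by
      intro t
      have hbc := hbσ.2.2.2.2.2.1 t
      have hσc := hbσ.2.2.2.2.2.2 t
      have c1 : Continuous fun p : ℝ × ℝ => Ut (t, p.1) := by fun_prop
      have c2 : Continuous fun p : ℝ × ℝ => Ux (t, p.1) := by fun_prop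
      have c3 : Continuous fun p : ℝ × ℝ => Uxx (t, p.1) := by fun_prop
      exact c1.continuousOn.add ((hbc.mul c2.continuousOn).add
        (((hσc.pow 2).div_const 2).mul c3.continuousOn))
    have htight : ∀ ε : ℝ, 0 < ε → ∃ K ⊆ closure O ×ˢ A, IsCompact K ∧
        (∀ n, (νn (φ n)).real (Prod.snd ⁻¹' Kᶜ) ≤ ε) ∧ ν.real (Prod.snd ⁻¹' Kᶜ) ≤ ε := by
      intro ε hε
      obtain ⟨K1, hK1, h1⟩ := htightν (ENNReal.ofReal ε) (ENNReal.ofReal_pos.2 hε)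
      obtain ⟨K2, hK2, h2⟩ := isTightMeasureSet_iff_exists_isCompact_measure_compl_le.1
        (isTightMeasureSet_singleton (μ := ν)) (ENNReal.ofReal ε) (ENNReal.ofReal_pos.2 hε)
      refine ⟨(Prod.snd '' (K1 ∪ K2)) ∩ (closure O ×ˢ A), inter_subset_right,
        ((hK1.union hK2).image continuous_snd).inter_right hSc, ?_⟩
      have key : ∀ (ρ : Measure (ℝ × ℝ × ℝ)), ρ (Icc 0 T ×ˢ (closure O ×ˢ A))ᶜ = 0 →
          ∀ K' ⊆ K1 ∪ K2, ρ K'ᶜ ≤ ENNReal.ofReal ε →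
          ρ.real (Prod.snd ⁻¹' ((Prod.snd '' (K1 ∪ K2)) ∩ (closure O ×ˢ A))ᶜ) ≤ ε := by
        intro ρ hρ K' hK' hle
        refine ENNReal.toReal_le_of_le_ofReal hε.le (le_trans (measure_mono_ae ?_) hle)
        have : ∀ᵐ q ∂ρ, q ∈ Icc 0 T ×ˢ (closure O ×ˢ A) := hρ
        filter_upwards [this] with q hq hqK hqK'
        exact hqK ⟨⟨q, hK' hqK', rfl⟩, hq.2⟩
      exact ⟨fun n => key _ (hνn (φ n)).supp K1 subset_union_left (h1 _),
        key ν hνsupp K2 subset_union_right (h2 ν rfl)⟩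
    have hFlim := aux_stable (fun n => νn (φ n)) ν (fun n => (hνn (φ n)).marg) hνmarg htight hνlim'
      hFm hFb hFc
    have hUlim := hμlim U hUc ⟨_, hUb⟩
    have hEq : ∀ n, ∫ p, U p ∂(μn (φ n)) = (∫ x, U (0, x) ∂m0) + ∫ q, F q ∂(νn (φ n)) := fun n =>
      aux_FP hbσ (hRn (φ n)) (hνn (φ n)) hcb hUtc hUxc hUxxc
    have hfinal : ∫ p, U p ∂μ = (∫ x, U (0, x) ∂m0) + ∫ q, F q ∂ν := by
      refine tendsto_nhds_unique hUlim ?_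
      simp only [hEq]
      exact hFlim.const_add _
    have e1 : ∫ p, u p.1 p.2 ∂μ = ∫ p, U p ∂μ := by
      refine integral_congr_ae ?_
      have : ∀ᵐ p ∂μ, p ∈ Icc 0 T ×ˢ closure O := hμsupp
      filter_upwards [this] with p hp
      exact (hU p hp).symm
    have e2 : ∫ x, u 0 x ∂m0 = ∫ x, U (0, x) ∂m0 := by
      refine integral_congr_ae ?_
      have : ∀ᵐ x ∂m0, x ∈ O := hm0.2.1
      filter_upwards [this] with x hx
      exact (hU (0, x) ⟨⟨le_rfl, hT.le⟩, subset_closure hx⟩).symm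
    have e3 : ∫ q, F q ∂ν = ∫ t in Icc 0 T, (∫ p, (ut t p.1 + (b t p.1 p.2 * ux t p.1
        + σ t p.1 p.2 ^ 2 / 2 * uxx t p.1)) ∂(m t)) := by
      rw [← hm.int F hFm ⟨_, fun t _ p _ => hFb (t, p)⟩]
      refine setIntegral_congr_fun measurableSet_Icc fun t ht => ?_
      refine integral_congr_ae ?_
      have : ∀ᵐ p ∂(m t), p ∈ closure O ×ˢ A := hmV.2.1 t
      filter_upwards [this] with p hp
      simp only [F, hUt (t, p.1) ⟨ht, hp.1⟩, hUx (t, p.1) ⟨ht, hp.1⟩, hUxx (t, p.1) ⟨ht, hp.1⟩]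
    rw [e1, e2, ← e3]
    exact hfinal
  · rintro h hh ⟨C, hC⟩
    have hb : ∃ C, ∀ t ∈ Icc 0 T, ∀ p ∈ closure O ×ˢ A, |(fun q : ℝ × ℝ × ℝ => h q.1 q.2) (t, p)| ≤ C :=
      ⟨C, fun t _ p _ => hC t p⟩
    have e : ∀ n, ∫ t in Icc 0 T, (∫ p, h t p ∂(mn (φ n) t)) = ∫ q, h q.1 q.2 ∂(νn (φ n)) :=
      fun n => (hνn (φ n)).int (fun q => h q.1 q.2) hh.measurable hb
    have e' : ∫ t in Icc 0 T, (∫ p, h t p ∂(m t)) = ∫ q, h q.1 q.2 ∂ν :=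
      hm.int (fun q => h q.1 q.2) hh.measurable hb
    simp only [e, e']
    exact hνlim' _ hh ⟨C, fun q => hC _ _⟩
end
end
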